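/- Every 2-connected k-regular graph on n vertices with k ≥ n/3 contains a Hamilton cycle. -/

import Mathlib

namespace Jackson

variable {V : Type*} {G : SimpleGraph V}

/-- A list of distinct vertices in which consecutive vertices are adjacent. -/
structure IsPathList (G : SimpleGraph V) (l : List V) : Prop where
  chain : l.IsChain G.Adj
  nodup : l.Nodup

/-- A list of at least three vertices tracing a cycle of `G`. -/
structure IsCycleList (G : SimpleGraph V) (l : List V) : Prop extends IsPathList G l where
  three_le : 3 ≤ l.length
  closes : ∀ a ∈ l.getLast?, ∀ b ∈ l.head?, G.Adj a b

/-- `a` and `b` occupy neighbouring positions in `l`, in either order. -/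
def Consec (l : List V) (a b : V) : Prop :=
  [a, b] <:+: l ∨ [b, a] <:+: l

theorem pair_infix_append {l₁ l₂ : List V} {a b : V} :
    [a, b] <:+: l₁ ++ l₂ ↔
      [a, b] <:+: l₁ ∨ [a, b] <:+: l₂ ∨ (a ∈ l₁.getLast? ∧ b ∈ l₂.head?) := by
  induction l₁ with
  | nil => simp
  | cons c t ih =>
    rw [List.cons_append, List.infix_cons_iff, ih, List.infix_cons_iff]
    cases t with
    | nil => cases l₂ <;> simp [List.prefix_cons_iff]; tauto
    | cons e s => simp [List.getLast?_cons_cons]; tauto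

theorem Consec.symm {l : List V} {a b : V} (h : Consec l a b) : Consec l b a := Or.symm h

theorem consec_append {l₁ l₂ : List V} {a b : V} :
    Consec (l₁ ++ l₂) a b ↔ Consec l₁ a b ∨ Consec l₂ a b ∨
      (a ∈ l₁.getLast? ∧ b ∈ l₂.head?) ∨ (b ∈ l₁.getLast? ∧ a ∈ l₂.head?) := by
  unfold Consec
  rw [pair_infix_append, pair_infix_append]
  tauto

theorem consec_reverse {l : List V} {a b : V} : Consec l.reverse a b ↔ Consec l a b := by
  unfold Consec
  rw [← List.reverse_infix (l₁ := [a, b]) (l₂ := l), ← List.reverse_infix (l₁ := [b, a]) (l₂ := l)]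
  simp [or_comm]

theorem Consec.mem_left {l : List V} {a b : V} (h : Consec l a b) : a ∈ l := by
  rcases h with h | h <;> exact h.subset (by simp)

theorem IsPathList.reverse {l : List V} (h : IsPathList G l) : IsPathList G l.reverse := by
  refine ⟨?_, List.nodup_reverse.2 h.nodup⟩
  rw [List.isChain_reverse]
  exact h.chain.imp fun _ _ hab => hab.symm

theorem IsPathList.append {l₁ l₂ : List V} (h₁ : IsPathList G l₁) (h₂ : IsPathList G l₂)
    (hd : ∀ a ∈ l₁, a ∉ l₂) (hadj : ∀ a ∈ l₁.getLast?, ∀ b ∈ l₂.head?, G.Adj a b) :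
    IsPathList G (l₁ ++ l₂) := by
  refine ⟨List.isChain_append.2 ⟨h₁.chain, h₂.chain, hadj⟩, ?_⟩
  rw [List.nodup_append]
  refine ⟨h₁.nodup, h₂.nodup, fun a ha b hb hab => hd a ha (hab ▸ hb)⟩

theorem isPathList_append {l₁ l₂ : List V} :
    IsPathList G (l₁ ++ l₂) ↔ IsPathList G l₁ ∧ IsPathList G l₂ ∧ (∀ a ∈ l₁, a ∉ l₂) ∧
      ∀ a ∈ l₁.getLast?, ∀ b ∈ l₂.head?, G.Adj a b := by
  constructor
  · rintro ⟨h, hn⟩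
    rw [List.isChain_append] at h
    rw [List.nodup_append] at hn
    exact ⟨⟨h.1, hn.1⟩, ⟨h.2.1, hn.2.1⟩, fun a ha hb => hn.2.2 a ha a hb rfl, h.2.2⟩
  · rintro ⟨h₁, h₂, hd, hadj⟩
    exact h₁.append h₂ hd hadj

theorem isPathList_singleton (a : V) : IsPathList G [a] := ⟨by simp, by simp⟩

/-- Two paths joined by a connecting path sharing only its ends with them. -/
theorem IsPathList.bridge {l₁ l₂ m : List V} {x y : V} (h₁ : IsPathList G l₁)
    (h₂ : IsPathList G l₂) (hm : IsPathList G ([x] ++ m ++ [y])) (hx : x ∈ l₁.getLast?)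
    (hy : y ∈ l₂.head?) (h₁₂ : ∀ a ∈ l₁, a ∉ l₂) (h₁m : ∀ a ∈ l₁, a ∉ m) (hm₂ : ∀ a ∈ m, a ∉ l₂) :
    IsPathList G (l₁ ++ (m ++ l₂)) := by
  rw [isPathList_append, isPathList_append] at hm
  obtain ⟨⟨-, hpm, -, hxm⟩, -, -, hmy⟩ := hm
  refine h₁.append (hpm.append h₂ hm₂ ?_) ?_ ?_
  · intro a ha b hb
    obtain rfl := Option.mem_unique hb hy
    refine hmy a ?_ b (by simp)
    rw [List.getLast?_append, Option.mem_def.1 ha]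
    rfl
  · simp only [List.mem_append, not_or]
    exact fun a ha => ⟨h₁m a ha, h₁₂ a ha⟩
  · intro a ha b hb
    obtain rfl := Option.mem_unique ha hx
    cases m with
    | nil =>
      obtain rfl := Option.mem_unique hb hy
      exact hmy a (by simp) b (by simp)
    | cons c t => exact hxm a (by simp) b (by simpa using hb)

theorem IsPathList.length_le_card [Fintype V] {l : List V} (h : IsPathList G l) :
    l.length ≤ Fintype.card V := h.nodup.length_le_card

/-- A cycle list through all vertices gives a Hamilton cycle. -/
theorem IsCycleList.isHamiltonian [Fintype V] [DecidableEq V] {l : List V} (h : IsCycleList G l)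
    (hall : ∀ a, a ∈ l) : G.IsHamiltonian := by
  intro _
  have hne : l ≠ [] := by
    rintro rfl
    simpa using h.three_le
  have hadj : G.Adj (l.getLast hne) (l.head hne) :=
    h.closes _ (List.getLast?_eq_some_getLast hne) _ (List.head?_eq_some_head hne)
  set w := SimpleGraph.Walk.ofSupport l hne h.chain with hw
  have hsupp : w.support = l := SimpleGraph.Walk.support_ofSupport hne h.chain
  have hpath : w.IsPath := by
    rw [SimpleGraph.Walk.isPath_def, hsupp]
    exact h.nodup
  refine ⟨_, SimpleGraph.Walk.cons hadj w, ?_⟩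
  rw [SimpleGraph.Walk.isHamiltonianCycle_iff_isCycle_and_support_count_tail_eq_one]
  constructor
  · rw [SimpleGraph.Walk.cons_isCycle_iff]
    refine ⟨hpath, fun hmem => ?_⟩
    have hlen := h.three_le
    have : w.length = 1 := hpath.length_eq_one_of_mem_edges (by rwa [Sym2.eq_swap])
    rw [hw, SimpleGraph.Walk.length_ofSupport] at this
    omega
  · intro a
    simp only [SimpleGraph.Walk.support_cons, List.tail_cons, hsupp]
    exact List.count_eq_one_of_mem h.nodup (hall a)

/-- A bi-infinite periodic parametrisation of a cycle of length `N`. -/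
structure IsCycleFun (G : SimpleGraph V) (N : ℕ) (d : ℤ → V) : Prop where
  three_le : 3 ≤ N
  per : ∀ j, d (j + N) = d j
  inj : ∀ i j, d i = d j → i < j + N → j < i + N → i = j
  adj : ∀ j, G.Adj (d j) (d (j + 1))

theorem IsCycleList.exists_isCycleFun {l : List V} (h : IsCycleList G l) :
    ∃ d, IsCycleFun G l.length d ∧ ∀ a, a ∈ l ↔ ∃ j, d j = a := by
  have h3 := h.three_le
  have hb (j : ℤ) : (j % (l.length : ℤ)).toNat < l.length := by
    have := Int.emod_nonneg j (b := l.length) (by omega)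
    have := Int.emod_lt_of_pos j (b := l.length) (by omega)
    omega
  refine ⟨fun j => getElem l (j % (l.length : ℤ)).toNat (hb j), ⟨h3, ?_, ?_, ?_⟩, ?_⟩
  · intro j
    simp
  · intro i j hij h1 h2
    have := (List.Nodup.getElem_inj_iff h.nodup).1 hij
    have hi := Int.emod_nonneg i (b := l.length) (by omega)
    have hj := Int.emod_nonneg j (b := l.length) (by omega)
    have he : i % (l.length : ℤ) = j % (l.length : ℤ) := by omega
    obtain ⟨c, hc⟩ : (l.length : ℤ) ∣ i - j := Int.ModEq.dvd (Int.ModEq.symm he)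
    have : c = 0 := by
      by_contra hne
      rcases lt_or_gt_of_ne hne with hlt | hgt
      · nlinarith
      · nlinarith
    subst this
    omega
  · intro j
    have hj := Int.emod_nonneg j (b := l.length) (by omega)
    have hj2 := Int.emod_lt_of_pos j (b := l.length) (by omega)
    by_cases hc : j % (l.length : ℤ) + 1 = l.length
    · have h0 : (j + 1) % (l.length : ℤ) = 0 := by
        rw [Int.add_emod, ← Int.emod_add_emod]
        simp [hc]
      apply h.closes
      · simp only [Option.mem_def, List.getLast?_eq_getElem?]
        rw [List.getElem?_eq_getElem (by omega)]
        congr 2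
        omega
      · simp only [Option.mem_def, List.head?_eq_getElem?, h0]
        rw [List.getElem?_eq_getElem (by omega)]
        simp
    · have h1 : (j + 1) % (l.length : ℤ) = j % (l.length : ℤ) + 1 := by
        rw [← Int.emod_add_emod]
        exact Int.emod_eq_of_lt (by omega) (by omega)
      have := List.isChain_iff_getElem.1 h.chain (j % (l.length : ℤ)).toNat (by omega)
      convert this using 2
      omega
  · intro a
    rw [List.mem_iff_getElem]
    constructor
    · rintro ⟨i, hi, rfl⟩
      refine ⟨i, ?_⟩
      dsimp only
      congr 1
      rw [Int.emod_eq_of_lt (by omega) (by omega)]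
      simp
    · rintro ⟨j, rfl⟩
      exact ⟨_, _, rfl⟩

namespace IsCycleFun

variable {N : ℕ} {d : ℤ → V}

theorem per_mul (h : IsCycleFun G N d) (j t : ℤ) : d (j + t * N) = d j := by
  induction t using Int.induction_on with
  | zero => simp
  | succ i ih => rw [← ih, ← h.per (j + i * N)]; ring_nf
  | pred i ih => rw [← ih, ← h.per (j + (-i - 1) * N)]; ring_nf

theorem exists_rep (h : IsCycleFun G N d) (a j : ℤ) :
    ∃ i, a ≤ i ∧ i < a + N ∧ d i = d j ∧ ∀ t, d (i + t) = d (j + t) := by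
  have h3 := h.three_le
  have e : j = a + (j - a) % N + (j - a) / N * N := by
    have := Int.emod_add_mul_ediv (j - a) N
    linarith [mul_comm ((j - a) / N) (N : ℤ)]
  refine ⟨a + (j - a) % N, ?_, ?_, ?_, ?_⟩
  · have := Int.emod_nonneg (j - a) (b := N) (by omega)
    omega
  · have := Int.emod_lt_of_pos (j - a) (b := N) (by omega)
    omega
  · conv_rhs => rw [e, h.per_mul]
  · intro t
    conv_rhs => rw [e, add_right_comm, h.per_mul]

theorem congr_add (h : IsCycleFun G N d) {i j : ℤ} (hij : d i = d j) (t : ℤ) :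
    d (i + t) = d (j + t) := by
  obtain ⟨i', h1, h2, h3, h4⟩ := h.exists_rep i j
  have : i = i' := h.inj i i' (hij.trans h3.symm) (by omega) (by omega)
  rw [this, h4]

theorem rev (h : IsCycleFun G N d) : IsCycleFun G N fun j => d (-j) where
  three_le := h.three_le
  per j := by
    have := h.per (-(j + N))
    rw [← this]
    ring_nf
  inj i j hij h1 h2 := by
    have := h.inj (-i) (-j) hij (by omega) (by omega)
    omega
  adj j := by
    have := (h.adj (-(j + 1))).symm
    rwa [show -(j + 1) + 1 = -j by ring] at this

end IsCycleFun

/-- The list `d a, d (a + 1), …, d (a + m - 1)`. -/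
def arc (d : ℤ → V) (a : ℤ) (m : ℕ) : List V := (List.range m).map fun i : ℕ => d (a + i)

section arc

variable {N : ℕ} {d : ℤ → V}

@[simp] theorem length_arc (a : ℤ) (m : ℕ) : (arc d a m).length = m := by simp [arc]

theorem mem_arc {a : ℤ} {m : ℕ} {c : V} :
    c ∈ arc d a m ↔ ∃ j, a ≤ j ∧ j < a + m ∧ d j = c := by
  simp only [arc, List.mem_map, List.mem_range]
  constructor
  · rintro ⟨i, hi, rfl⟩
    exact ⟨a + i, by omega, by omega, rfl⟩
  · rintro ⟨j, h1, h2, rfl⟩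
    refine ⟨(j - a).toNat, by omega, ?_⟩
    congr 1
    omega

theorem head?_arc {a : ℤ} {m : ℕ} {c : V} : c ∈ (arc d a m).head? ↔ 0 < m ∧ d a = c := by
  cases m with
  | zero => simp [arc]
  | succ m => simp [arc, List.head?_range]

theorem getLast?_arc {a : ℤ} {m : ℕ} {c : V} :
    c ∈ (arc d a m).getLast? ↔ 0 < m ∧ d (a + m - 1) = c := by
  cases m with
  | zero => simp [arc]
  | succ m => simp [arc, List.getLast?_range, add_sub_assoc]

theorem arc_add (a : ℤ) (m n : ℕ) : arc d a (m + n) = arc d a m ++ arc d (a + m) n := by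
  simp [arc, List.range_add, add_assoc]

theorem consec_arc {a : ℤ} {m : ℕ} {j : ℤ} (h1 : a ≤ j) (h2 : j + 1 < a + m) :
    Consec (arc d a m) (d j) (d (j + 1)) := by
  left
  obtain ⟨s, rfl⟩ : ∃ s : ℕ, j = a + s := ⟨(j - a).toNat, by omega⟩
  obtain ⟨r, rfl⟩ : ∃ r : ℕ, m = s + (2 + r) := ⟨m - s - 2, by omega⟩
  rw [arc_add, arc_add]
  refine ⟨arc d a s, arc d (a + s + 2) r, ?_⟩
  simp [arc, List.range_succ]

theorem isPathList_arc (h : IsCycleFun G N d) {a : ℤ} {m : ℕ} (hm : m ≤ N) :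
    IsPathList G (arc d a m) := by
  constructor
  · rw [List.isChain_iff_getElem]
    intro i hi
    simp only [arc, List.getElem_map, List.getElem_range]
    convert h.adj (a + i) using 2
    push_cast; ring
  · refine List.Nodup.map_on ?_ List.nodup_range
    intro i hi j hj hij
    rw [List.mem_range] at hi hj
    have := h.inj _ _ hij (by omega) (by omega)
    omega

theorem isCycleList_arc (h : IsCycleFun G N d) (a : ℤ) : IsCycleList G (arc d a N) := by
  refine ⟨isPathList_arc h le_rfl, by simpa using h.three_le, ?_⟩
  intro x hx y hy
  rw [← (getLast?_arc.1 hx).2, ← (head?_arc.1 hy).2, ← h.per a]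
  convert h.adj (a + N - 1) using 2
  ring

theorem mem_arc_full (h : IsCycleFun G N d) (a : ℤ) {c : V} : c ∈ arc d a N ↔ ∃ j, d j = c := by
  rw [mem_arc]
  constructor
  · rintro ⟨j, -, -, hj⟩
    exact ⟨j, hj⟩
  · rintro ⟨j, rfl⟩
    obtain ⟨i, h1, h2, h3, -⟩ := h.exists_rep a j
    exact ⟨i, h1, h2, h3⟩

end arc

end Jackson

namespace Jackson

variable {V : Type*} {G : SimpleGraph V} {N : ℕ} {d : ℤ → V} {v : V}

/-- Every edge of the cycle `d` meeting `S` is traversed by the list `l`. -/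
def Keeps (d : ℤ → V) (S : Set V) (l : List V) : Prop :=
  ∀ j, d j ∈ S ∨ d (j + 1) ∈ S → Consec l (d j) (d (j + 1))

theorem Keeps.mono {S T : Set V} {l : List V} (h : Keeps d T l) (hST : S ⊆ T) : Keeps d S l :=
  fun j hj => h j (hj.imp (@hST _) (@hST _))

theorem Keeps.reverse {S : Set V} {l : List V} (h : Keeps d S l) : Keeps d S l.reverse :=
  fun j hj => consec_reverse.2 (h j hj)

/-- Any path avoiding `v`, with both ends in `X`, that traverses all edges of the cycle `d` at `Y`,
can be turned into a cycle through `v` and the vertices of the path. -/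
def HopProp (G : SimpleGraph V) (d : ℤ → V) (v : V) (Y X : Set V) : Prop :=
  ∀ l, IsPathList G l → v ∉ l → 2 ≤ l.length → (∀ a ∈ l.head?, a ∈ X) →
    (∀ a ∈ l.getLast?, a ∈ X) → Keeps d Y l →
    ∃ l', IsCycleList G l' ∧ l'.length = l.length + 1 ∧ ∀ a, a ∈ l' ↔ a = v ∨ a ∈ l

/-- A vertex `y` whose two cycle edges are traversed by the duplicate-free list `l` is flanked
in `l` by its two neighbours on the cycle. -/
theorem Keeps.exists_split (hd : IsCycleFun G N d) {S : Set V} {l : List V} (hl : l.Nodup)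
    (hk : Keeps d S l) {j : ℤ} (hj : d j ∈ S) :
    ∃ l₁ e f l₂, l = l₁ ++ [e] ++ d j :: f :: l₂ ∧
      (e = d (j - 1) ∧ f = d (j + 1) ∨ e = d (j + 1) ∧ f = d (j - 1)) := by
  have hne : d (j - 1) ≠ d (j + 1) := by
    intro h
    have h3 := hd.three_le
    have := hd.inj _ _ h (by omega) (by omega)
    omega
  have h1 := hk j (Or.inl hj)
  have h2 := hk (j - 1) (Or.inr (by simpa using hj))
  rw [sub_add_cancel] at h2
  obtain ⟨s, t, rfl⟩ := List.append_of_mem h1.mem_left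
  have key : ∀ c, Consec (s ++ d j :: t) (d j) c → c ∈ s.getLast? ∨ c ∈ t.head? := by
    intro c hc
    have hns : d j ∉ s := by
      intro hmem
      rw [List.nodup_append] at hl
      exact hl.2.2 _ hmem _ (by simp) rfl
    have hnt : d j ∉ t := by
      rw [List.nodup_append] at hl
      exact (List.nodup_cons.1 hl.2.1).1
    rw [consec_append] at hc
    rcases hc with hc | hc | hc | hc
    · exact absurd hc.mem_left hns
    · rw [← List.singleton_append, consec_append] at hc
      rcases hc with hc | hc | hc | hc
      · rcases hc with hc | hc <;> simpa using hc.length_le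
      · exact absurd hc.mem_left hnt
      · exact Or.inr hc.2
      · exact absurd (List.mem_of_mem_head? hc.2) hnt
    · exact absurd (List.mem_of_mem_getLast? hc.1) hns
    · exact Or.inl hc.1
  have k1 := key _ h1
  have k2 := key _ h2.symm
  rcases List.eq_nil_or_concat s with rfl | ⟨s', e, rfl⟩
  · cases t with
    | nil => simp at k1
    | cons f t => simp at k1 k2; exact absurd (k2.symm.trans k1) hne
  · cases t with
    | nil => simp at k1 k2; exact absurd (k2.symm.trans k1) hne
    | cons f t =>
      simp at k1 k2
      refine ⟨s', e, f, t, by simp, ?_⟩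
      rcases k1 with rfl | rfl <;> rcases k2 with k2 | k2
      · exact absurd k2.symm hne
      · exact Or.inr ⟨rfl, k2⟩
      · exact Or.inl ⟨k2, rfl⟩
      · exact absurd k2.symm hne

theorem Keeps.rotate {S : Set V} {l₁ l₂ : List V} {e y : V} (hk : Keeps d S (l₁ ++ [e] ++ y :: l₂))
    (he : e ∉ S) : Keeps d (S \ {y}) ((l₁ ++ [e]).reverse ++ y :: l₂) := by
  intro j hj
  have h := hk j (hj.imp And.left And.left)
  rw [consec_append] at h ⊢
  rcases h with h | h | ⟨h1, h2⟩ | ⟨h1, h2⟩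
  · exact Or.inl (consec_reverse.2 h)
  · exact Or.inr (Or.inl h)
  · simp at h1 h2
    exfalso
    rcases hj with hj | hj
    · exact he (h1 ▸ hj.1)
    · exact hj.2 h2.symm
  · simp at h1 h2
    exfalso
    rcases hj with hj | hj
    · exact hj.2 h2.symm
    · exact he (h1 ▸ hj.1)

/-- Rotating a path at its first vertex, along an edge to a flanked vertex `d j`. -/
theorem Keeps.exists_rotation (hd : IsCycleFun G N d) {S : Set V} {l : List V}
    (hl : IsPathList G l) (hk : Keeps d S l) {j : ℤ} (hj : d j ∈ S) (h1 : d (j - 1) ∉ S)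
    (h2 : d (j + 1) ∉ S) (hadj : ∀ x ∈ l.head?, G.Adj (d j) x) :
    ∃ l', IsPathList G l' ∧ l'.length = l.length ∧ (∀ a, a ∈ l' ↔ a ∈ l) ∧
      Keeps d (S \ {d j}) l' ∧ (∀ a ∈ l'.head?, a = d (j - 1) ∨ a = d (j + 1)) ∧
      l'.getLast? = l.getLast? := by
  obtain ⟨l₁, e, f, l₂, rfl, hef⟩ := hk.exists_split hd hl.nodup hj
  refine ⟨(l₁ ++ [e]).reverse ++ d j :: f :: l₂, ?_, by simp; omega, by simp; tauto,
    hk.rotate ?_, ?_, by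
      rw [List.getLast?_append_of_ne_nil _ (by simp), List.getLast?_append_of_ne_nil _ (by simp)]⟩
  · rw [isPathList_append] at hl
    refine hl.1.reverse.append hl.2.1 (fun a ha => hl.2.2.1 a (List.mem_reverse.1 ha)) ?_
    intro a ha b hb
    rw [List.getLast?_reverse] at ha
    simp at hb
    subst hb
    refine (hadj a ?_).symm
    rw [List.head?_append, Option.mem_def.1 ha]
    simp
  · rcases hef with ⟨rfl, _⟩ | ⟨rfl, _⟩ <;> assumption
  · simp
    tauto

theorem IsPathList.hop_base {l : List V} (hl : IsPathList G l) (hv : v ∉ l) (h2 : 2 ≤ l.length)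
    (hh : ∀ a ∈ l.head?, G.Adj v a) (ht : ∀ a ∈ l.getLast?, G.Adj v a) :
    ∃ l', IsCycleList G l' ∧ l'.length = l.length + 1 ∧ ∀ a, a ∈ l' ↔ a = v ∨ a ∈ l := by
  refine ⟨[v] ++ l, ⟨(isPathList_singleton v).append hl (by simpa using hv) (by simpa using hh),
    by simp; omega, ?_⟩, by simp, by simp⟩
  intro a ha b hb
  simp at hb
  subst hb
  refine (ht a ?_).symm
  cases l with
  | nil => simp at h2
  | cons c t => simpa using ha

mutual
/-- Hopping sets: the vertices joined to `v` or to a member of the current `hopY`. -/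
def hopX (G : SimpleGraph V) (d : ℤ → V) (v : V) : ℕ → Set V
  | i => {x | G.Adj v x ∨ ∃ y ∈ hopY G d v i, G.Adj y x}
termination_by i => (i, 1)
/-- Hopping sets: the cycle vertices both of whose cycle neighbours lie in the previous `hopX`. -/
def hopY (G : SimpleGraph V) (d : ℤ → V) (v : V) : ℕ → Set V
  | 0 => ∅
  | i + 1 => {y | ∃ j, d j = y ∧ d (j - 1) ∈ hopX G d v i ∧ d (j + 1) ∈ hopX G d v i}
termination_by i => (i, 0)
end

theorem mem_hopX {i : ℕ} {x : V} :
    x ∈ hopX G d v i ↔ G.Adj v x ∨ ∃ y ∈ hopY G d v i, G.Adj y x := by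
  rw [hopX]; rfl

theorem mem_hopY_succ {i : ℕ} {y : V} : y ∈ hopY G d v (i + 1) ↔
    ∃ j, d j = y ∧ d (j - 1) ∈ hopX G d v i ∧ d (j + 1) ∈ hopX G d v i := by
  rw [hopY]; rfl

theorem hopX_subset_of_hopY_subset {i i' : ℕ} (h : hopY G d v i ⊆ hopY G d v i') :
    hopX G d v i ⊆ hopX G d v i' := by
  intro x hx
  rw [mem_hopX] at hx ⊢
  exact hx.imp_right fun ⟨y, hy, hyx⟩ => ⟨y, h hy, hyx⟩

theorem hopY_subset_succ (i : ℕ) : hopY G d v i ⊆ hopY G d v (i + 1) := by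
  induction i with
  | zero => rw [hopY]; exact Set.empty_subset _
  | succ i ih =>
    intro y hy
    rw [mem_hopY_succ] at hy ⊢
    obtain ⟨j, hj, h1, h2⟩ := hy
    exact ⟨j, hj, hopX_subset_of_hopY_subset ih h1, hopX_subset_of_hopY_subset ih h2⟩

theorem hopY_mono : Monotone (hopY G d v) := monotone_nat_of_le_succ hopY_subset_succ

/-- Consecutive vertices of a longest cycle are not both ends of a hop. -/
theorem HopProp.not_consecutive (hd : IsCycleFun G N d) (hmax : ∀ l, IsCycleList G l → l.length ≤ N)
    (hv : ∀ j, d j ≠ v) {Y X : Set V} (h : HopProp G d v Y X) (hXY : ∀ x ∈ X, x ∉ Y) (j : ℤ)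
    (h1 : d j ∈ X) (h2 : d (j + 1) ∈ X) : False := by
  have h3 := hd.three_le
  have hper : d (j + N) = d j := hd.per j
  obtain ⟨l', hl', hlen, -⟩ := h (arc d (j + 1) N) (isPathList_arc hd le_rfl)
    (by rw [mem_arc]; rintro ⟨i, -, -, hi⟩; exact hv i hi) (by simp; omega)
    (by intro a ha; rw [head?_arc] at ha; exact ha.2 ▸ h2)
    (by
      intro a ha
      rw [getLast?_arc, show j + 1 + (N : ℤ) - 1 = j + N by ring, hper] at ha
      exact ha.2 ▸ h1)
    (by
      intro t ht
      obtain ⟨i, hi1, hi2, hi3, hi4⟩ := hd.exists_rep (j + 1) t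
      rw [← hi3, ← hi4] at ht ⊢
      by_cases hi : i = j + N
      · subst hi
        rw [hper, add_right_comm, hd.per] at ht
        rcases ht with ht | ht
        · exact absurd ht (hXY _ h1)
        · exact absurd ht (hXY _ h2)
      · exact consec_arc hi1 (by omega))
  have := hmax l' hl'
  simp at hlen
  omega

/-- Two vertices `d a`, `d b` followed on a longest cycle by members of `X` are not joined by a
path that is otherwise disjoint from the cycle. -/
theorem HopProp.not_isPathList_bridge (hd : IsCycleFun G N d)
    (hmax : ∀ l, IsCycleList G l → l.length ≤ N)
    (hv : ∀ j, d j ≠ v) {Y X : Set V} (h : HopProp G d v Y X) (hXY : ∀ x ∈ X, x ∉ Y) (a b : ℤ)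
    (ha : d a ∉ Y) (hb : d b ∉ Y) (ha' : d (a + 1) ∈ X) (hb' : d (b + 1) ∈ X) {m : List V}
    (hm : ∀ c ∈ m, c ≠ v ∧ ∀ j, d j ≠ c) (hpath : IsPathList G ([d b] ++ m ++ [d a])) : False := by
  have h3 := hd.three_le
  obtain ⟨b', hb1, hb2, hb3, hb4⟩ := hd.exists_rep a b
  rw [← hb3] at hpath hb
  rw [← hb4] at hb'
  clear hb3 hb4
  have hab : a ≠ b' := by
    rintro rfl
    simpa using hpath.nodup
  obtain ⟨s, rfl⟩ : ∃ s : ℕ, b' = a + s := ⟨(b' - a).toNat, by omega⟩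
  have hs : 0 < s := by omega
  have hsN : s < N := by omega
  have hper : d (a + N) = d a := hd.per a
  obtain ⟨l', hl', hlen, -⟩ := h (arc d (a + 1) s ++ (m ++ (arc d (a + s + 1) (N - s)).reverse))
    (by
      refine (isPathList_arc hd hsN.le).bridge (isPathList_arc hd (by omega)).reverse hpath ?_ ?_
        ?_ ?_ ?_
      · rw [getLast?_arc]
        exact ⟨hs, by congr 1; ring⟩
      · rw [List.head?_reverse, getLast?_arc]
        refine ⟨by omega, ?_⟩
        rw [← hper]
        congr 1
        omega
      · intro c hc hc'
        rw [List.mem_reverse] at hc'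
        obtain ⟨i, hi1, hi2, rfl⟩ := mem_arc.1 hc
        obtain ⟨i', hi1', hi2', he⟩ := mem_arc.1 hc'
        have := hd.inj _ _ he (by omega) (by omega)
        omega
      · intro c hc hc'
        obtain ⟨i, -, -, rfl⟩ := mem_arc.1 hc
        exact (hm _ hc').2 i rfl
      · intro c hc hc'
        obtain ⟨i, -, -, rfl⟩ := mem_arc.1 (List.mem_reverse.1 hc')
        exact (hm _ hc).2 i rfl)
    (by
      simp only [List.mem_append, List.mem_reverse, mem_arc]
      rintro (⟨i, -, -, hi⟩ | hi | ⟨i, -, -, hi⟩)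
      · exact hv i hi
      · exact (hm _ hi).1 rfl
      · exact hv i hi)
    (by simp; omega)
    (by
      intro c hc
      rw [List.head?_append, Option.mem_def, Option.or_eq_some_iff] at hc
      rcases hc with hc | hc
      · exact (head?_arc.1 hc).2 ▸ ha'
      · have := (head?_arc (d := d) (a := a + 1) (c := d (a + 1))).2 ⟨hs, rfl⟩
        rw [hc.1] at this
        simp at this)
    (by
      intro c hc
      rw [← List.append_assoc, List.getLast?_append, List.getLast?_reverse, Option.mem_def,
        Option.or_eq_some_iff] at hc
      rcases hc with hc | hc
      · exact (head?_arc.1 hc).2 ▸ hb'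
      · have := (head?_arc (d := d) (a := a + s + 1) (c := d (a + s + 1))).2
          ⟨show 0 < N - s by omega, rfl⟩
        rw [hc.1] at this
        simp at this)
    (by
      intro t ht
      obtain ⟨i, hi1, hi2, hi3, hi4⟩ := hd.exists_rep (a + 1) t
      rw [← hi3, ← hi4] at ht ⊢
      rw [consec_append, consec_append, consec_reverse]
      by_cases hia : i = a + N
      · subst hia
        rw [hper, add_right_comm, hd.per] at ht
        exact (ht.elim ha (hXY _ ha')).elim
      · by_cases hib : i = a + s
        · subst hib
          exact (ht.elim hb (hXY _ hb')).elim
        · by_cases hlt : i < a + s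
          · exact Or.inl (consec_arc hi1 (by omega))
          · exact Or.inr (Or.inl (Or.inr (Or.inl (consec_arc (by omega) (by omega))))))
  have := hmax l' hl'
  simp at hlen
  omega

/-- Two vertices `d a`, `d b` followed on the cycle by members of `X` are not adjacent. -/
theorem HopProp.not_adj_of_succ_mem (hd : IsCycleFun G N d)
    (hmax : ∀ l, IsCycleList G l → l.length ≤ N)
    (hv : ∀ j, d j ≠ v) {Y X : Set V} (h : HopProp G d v Y X) (hXY : ∀ x ∈ X, x ∉ Y) (a b : ℤ)
    (ha : d a ∉ Y) (hb : d b ∉ Y) (ha' : d (a + 1) ∈ X) (hb' : d (b + 1) ∈ X) :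
    ¬ G.Adj (d a) (d b) := fun hadj =>
  h.not_isPathList_bridge hd hmax hv hXY a b ha hb ha' hb' (m := []) (by simp)
    ⟨by simpa using hadj.symm, by simpa using hadj.ne'⟩

theorem HopProp.succ (hd : IsCycleFun G N d) {i : ℕ}
    (h : HopProp G d v (hopY G d v i) (hopX G d v i))
    (hXY' : ∀ x ∈ hopX G d v i, x ∉ hopY G d v (i + 1)) :
    HopProp G d v (hopY G d v (i + 1)) (hopX G d v (i + 1)) := by
  set X := hopX G d v i with hX
  set Y := hopY G d v i with hY
  set X' := hopX G d v (i + 1) with hX'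
  set Y' := hopY G d v (i + 1) with hY'
  have hYY' : Y ⊆ Y' := hopY_subset_succ i
  have hYrep : ∀ y ∈ Y', ∃ j, d j = y ∧ d (j - 1) ∈ X ∧ d (j + 1) ∈ X :=
    fun y hy => mem_hopY_succ.1 hy
  have hnew : ∀ x ∈ X', x ∉ X → ∃ y ∈ Y', y ∉ Y ∧ G.Adj y x := by
    intro x hx hxX
    rw [hX', mem_hopX] at hx
    rw [hX, mem_hopX] at hxX
    push Not at hxX
    rcases hx with hx | ⟨y, hy, hyx⟩
    · exact absurd hx hxX.1
    · exact ⟨y, hy, fun hyY => hxX.2 y hyY hyx, hyx⟩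
  -- paths whose last vertex lies in the smaller set `X`
  have close : ∀ S : Set V, Y ⊆ S → S ⊆ Y' → ∀ l, IsPathList G l → v ∉ l → 2 ≤ l.length →
      (∀ a ∈ l.getLast?, a ∈ X) → (∀ a ∈ l.head?, a ∈ X ∨ ∃ y ∈ S, y ∉ Y ∧ G.Adj y a) →
      Keeps d S l →
      ∃ l', IsCycleList G l' ∧ l'.length = l.length + 1 ∧ ∀ a, a ∈ l' ↔ a = v ∨ a ∈ l := by
    intro S hYS hSY' l hl hvl h2 hlast hhead hk
    by_cases hx : ∀ a ∈ l.head?, a ∈ X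
    · exact h l hl hvl h2 hx hlast (hk.mono hYS)
    push Not at hx
    obtain ⟨x, hxh, hxX⟩ := hx
    obtain ⟨y, hyS, hyY, hyx⟩ := (hhead x hxh).resolve_left hxX
    obtain ⟨j, rfl, hj1, hj2⟩ := hYrep y (hSY' hyS)
    obtain ⟨l', hl', hlen, hmem, hk', hh', hg'⟩ := hk.exists_rotation hd hl hyS
      (fun hc => hXY' _ hj1 (hSY' hc)) (fun hc => hXY' _ hj2 (hSY' hc))
      (fun a ha => by rw [Option.mem_unique ha hxh]; exact hyx)
    obtain ⟨l'', h1, h2, h3⟩ := h l' hl' (by rwa [hmem]) (by omega)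
      (fun a ha => by rcases hh' a ha with rfl | rfl <;> assumption) (by rwa [hg'])
      (hk'.mono fun y hy => ⟨hYS hy, by rintro rfl; exact hyY hy⟩)
    exact ⟨l'', h1, by omega, fun a => by rw [h3, hmem]⟩
  intro l hl hvl h2 hhead hlast hk
  by_cases hx : ∀ a ∈ l.head?, a ∈ X
  · obtain ⟨l', h1, h3, h4⟩ := close Y' hYY' subset_rfl l.reverse hl.reverse (by simpa using hvl)
      (by simpa using h2) (by simpa using hx)
      (fun a ha => by
        rw [List.head?_reverse] at ha
        by_cases haX : a ∈ X
        · exact Or.inl haX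
        · exact Or.inr (hnew a (hlast a ha) haX)) hk.reverse
    exact ⟨l', h1, by simpa using h3, by simpa using h4⟩
  by_cases hx' : ∀ a ∈ l.getLast?, a ∈ X
  · exact close Y' hYY' subset_rfl l hl hvl h2 hx' (fun a ha => by
        by_cases haX : a ∈ X
        · exact Or.inl haX
        · exact Or.inr (hnew a (hhead a ha) haX)) hk
  push Not at hx hx'
  obtain ⟨x, hxh, hxX⟩ := hx
  obtain ⟨x', hxh', hxX'⟩ := hx'
  obtain ⟨y, hyY', hyY, hyx⟩ := hnew x (hhead x hxh) hxX
  obtain ⟨y', hyY'', hyY1, hyx'⟩ := hnew x' (hlast x' hxh') hxX'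
  obtain ⟨j, rfl, hj1, hj2⟩ := hYrep y hyY'
  by_cases hyy : y' = d j
  · subst hyy
    obtain ⟨l₁, e, f, l₂, rfl, hef⟩ := hk.exists_split hd hl.nodup hyY'
    have he : e ∈ X := by rcases hef with ⟨rfl, _⟩ | ⟨rfl, _⟩ <;> assumption
    have hf : f ∈ X := by rcases hef with ⟨_, rfl⟩ | ⟨_, rfl⟩ <;> assumption
    rw [isPathList_append] at hl
    obtain ⟨hp1, hp2, hdis, -⟩ := hl
    rw [← List.singleton_append, isPathList_append] at hp2
    obtain ⟨-, hp2, hdis2, -⟩ := hp2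
    have hkk : Keeps d Y ((l₁ ++ [e]).reverse ++ ([d j] ++ (f :: l₂).reverse)) := by
      have := hk.rotate (hXY' _ he)
      intro t ht
      have := this t (ht.imp (fun h => ⟨hYY' h, fun hc => hyY (hc ▸ h)⟩)
        (fun h => ⟨hYY' h, fun hc => hyY (hc ▸ h)⟩))
      rw [consec_append] at this
      rw [consec_append]
      rcases this with this | this | this | this
      · exact Or.inl this
      · rw [← List.singleton_append, consec_append] at this
        right; left
        rw [consec_append, consec_reverse]
        rcases this with this | this | this | this
        · exact Or.inl this
        · exact Or.inr (Or.inl this)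
        · exfalso
          simp at this
          rw [← this.1, ← this.2] at ht
          exact ht.elim hyY fun hc => hXY' _ hf (hYY' hc)
        · exfalso
          simp at this
          rw [← this.1, ← this.2] at ht
          exact ht.elim (fun hc => hXY' _ hf (hYY' hc)) hyY
      · exact Or.inr (Or.inr (Or.inl (by simpa using this)))
      · exact Or.inr (Or.inr (Or.inr (by simpa using this)))
    obtain ⟨l', h1, h3, h4⟩ := h ((l₁ ++ [e]).reverse ++ ([d j] ++ (f :: l₂).reverse))
      (by
        refine hp1.reverse.append ((isPathList_singleton _).append hp2.reverse ?_ ?_) ?_ ?_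
        · intro a ha hc
          exact hdis2 a ha (List.mem_reverse.1 hc)
        · intro a ha b hb
          simp at ha
          subst ha
          rw [List.head?_reverse] at hb
          rw [Option.mem_unique (a := b) (b := x') hb (by simpa using hxh')]
          exact hyx'
        · intro a ha hc
          refine hdis a (List.mem_reverse.1 ha) ?_
          simp at hc ⊢
          tauto
        · intro a ha b hb
          rw [List.getLast?_reverse] at ha
          simp at hb
          subst hb
          refine (?_ : G.Adj _ _).symm
          rw [Option.mem_unique (a := a) (b := x) ha (by
            rw [List.head?_append, Option.mem_def, Option.or_eq_some_iff] at hxh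
            rcases hxh with hxh | hxh
            · exact hxh
            · simp at hxh)]
          exact hyx)
      (by simp at hvl ⊢; tauto) (by simp; omega) (by simpa using he)
      (by
        intro a ha
        rw [List.getLast?_append_of_ne_nil _ (by simp), List.getLast?_append_of_ne_nil _ (by simp),
          List.getLast?_reverse] at ha
        simp at ha
        exact ha ▸ hf) hkk
    exact ⟨l', h1, by simp at h3 ⊢; omega, fun a => by rw [h4]; simp; tauto⟩
  · obtain ⟨l', hl', hlen, hmem, hk', hh', hg'⟩ := hk.exists_rotation hd hl hyY'
      (hXY' _ hj1) (hXY' _ hj2)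
      (fun a ha => by rw [Option.mem_unique ha hxh]; exact hyx)
    obtain ⟨l'', h1, h3, h4⟩ := close (Y' \ {d j})
      (fun y hy => ⟨hYY' hy, by rintro rfl; exact hyY hy⟩) Set.sdiff_subset l'.reverse hl'.reverse
      (by simpa [hmem] using hvl) (by simpa [hlen] using h2)
      (fun a ha => by
        rw [List.getLast?_reverse] at ha
        rcases hh' a ha with rfl | rfl <;> assumption)
      (fun a ha => by
        rw [List.head?_reverse, hg'] at ha
        rw [Option.mem_unique ha hxh']
        exact Or.inr ⟨y', ⟨hyY'', hyy⟩, hyY1, hyx'⟩) hk'.reverse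
    exact ⟨l'', h1, by simpa [hlen] using h3, fun a => by rw [h4]; simp [hmem]⟩

/-- The hopping lemma, level by level. -/
theorem hopProp_hop (hd : IsCycleFun G N d) (hmax : ∀ l, IsCycleList G l → l.length ≤ N)
    (hv : ∀ j, d j ≠ v) (i : ℕ) :
    HopProp G d v (hopY G d v i) (hopX G d v i) ∧
      (∀ x ∈ hopX G d v i, x ∉ hopY G d v i) ∧ ∀ x ∈ hopX G d v i, x ∉ hopY G d v (i + 1) := by
  have succ_disj : ∀ i, HopProp G d v (hopY G d v i) (hopX G d v i) →
      (∀ x ∈ hopX G d v i, x ∉ hopY G d v i) → ∀ x ∈ hopX G d v i, x ∉ hopY G d v (i + 1) := by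
    intro i h1 h2 x hx hx'
    rw [mem_hopY_succ] at hx'
    obtain ⟨j, rfl, -, hj⟩ := hx'
    exact h1.not_consecutive hd hmax hv h2 j hx hj
  induction i with
  | zero =>
    have h0 : hopY G d v 0 = ∅ := by rw [hopY]
    have hb : HopProp G d v (hopY G d v 0) (hopX G d v 0) := by
      intro l hl hvl h2 hh ht _
      refine hl.hop_base hvl h2 (fun a ha => ?_) (fun a ha => ?_)
      · simpa [mem_hopX, h0] using hh a ha
      · simpa [mem_hopX, h0] using ht a ha
    have hdis : ∀ x ∈ hopX G d v 0, x ∉ hopY G d v 0 := by simp [h0]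
    exact ⟨hb, hdis, succ_disj 0 hb hdis⟩
  | succ i ih =>
    obtain ⟨h1, h2, h3⟩ := ih
    have hs := h1.succ hd h3
    have hdis : ∀ x ∈ hopX G d v (i + 1), x ∉ hopY G d v (i + 1) := by
      intro x hx hxY
      rw [mem_hopX] at hx
      rcases hx with hx | ⟨y, hy, hyx⟩
      · exact h3 x (mem_hopX.2 (Or.inl hx)) hxY
      · by_cases hxY0 : x ∈ hopY G d v i
        · exact h3 y (mem_hopX.2 (Or.inr ⟨x, hxY0, hyx.symm⟩)) hy
        by_cases hyY0 : y ∈ hopY G d v i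
        · exact h3 x (mem_hopX.2 (Or.inr ⟨y, hyY0, hyx⟩)) hxY
        obtain ⟨a, rfl, -, ha⟩ := mem_hopY_succ.1 hxY
        obtain ⟨b, rfl, -, hb⟩ := mem_hopY_succ.1 hy
        exact h1.not_adj_of_succ_mem hd hmax hv h2 a b hxY0 hyY0 ha hb hyx.symm
    exact ⟨hs, hdis, succ_disj _ hs hdis⟩

end Jackson

namespace Jackson

variable {V : Type*} {G : SimpleGraph V} {N : ℕ} {d : ℤ → V} {v : V}

theorem Keeps.of_rev {S : Set V} {l : List V} (h : Keeps (fun j => d (-j)) S l) : Keeps d S l := by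
  intro j hj
  have := h (-(j + 1)) (by simpa [or_comm] using hj)
  simpa using this.symm

theorem HopProp.rev {Y X : Set V} (h : HopProp G d v Y X) :
    HopProp G (fun j => d (-j)) v Y X :=
  fun l hl hvl h2 hh ht hk => h l hl hvl h2 hh ht hk.of_rev

/-- Reversing the segment `d p, …, d (p + e - 1)` and inserting it between `d j` and `d (j + 1)`
does not give a path. -/
theorem HopProp.not_insert_segment (hd : IsCycleFun G N d)
    (hmax : ∀ l, IsCycleList G l → l.length ≤ N) (hv : ∀ j, d j ≠ v) {Y X : Set V}
    (h : HopProp G d v Y X) (hXY : ∀ x ∈ X, x ∉ Y) {p j : ℤ} {e : ℕ} (he : 0 < e)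
    (hp : d (p - 1) ∈ X) (hpe : d (p + e) ∈ X) (hpY : d p ∉ Y) (hpeY : d (p + e - 1) ∉ Y)
    (hj : p + e ≤ j) (hjN : j + 1 ≤ p + N - 1) (hjY : d j ∉ Y) (hjY' : d (j + 1) ∉ Y)
    (h1 : G.Adj (d p) (d (j + 1))) : ¬ G.Adj (d (p + e - 1)) (d j) := by
  intro h2
  have h3 := hd.three_le
  obtain ⟨s, rfl⟩ : ∃ s : ℕ, j = p + e + s := ⟨(j - (p + e)).toNat, by omega⟩
  obtain ⟨r, rfl⟩ : ∃ r : ℕ, N = e + s + 2 + r := ⟨N - (e + s + 2), by omega⟩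
  have hper : d (p + (e + s + 2 + r : ℕ) - 1) = d (p - 1) := by
    rw [← hd.per (p - 1)]; congr 1; ring
  have hXp := hXY _ hp
  have hXpe := hXY _ hpe
  obtain ⟨l', hl', hlen, -⟩ := h (arc d (p + e) (s + 1) ++ ((arc d p e).reverse ++
      arc d (p + e + s + 1) (r + 1)))
    (by
      refine (isPathList_arc hd (by omega)).append ((isPathList_arc hd (by omega)).reverse.append
        (isPathList_arc hd (by omega)) ?_ ?_) ?_ ?_
      · intro c hc hc'
        obtain ⟨i, hi1, hi2, rfl⟩ := mem_arc.1 (List.mem_reverse.1 hc)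
        obtain ⟨i', hi1', hi2', he⟩ := mem_arc.1 hc'
        have := hd.inj _ _ he (by omega) (by omega)
        omega
      · intro x hx y hy
        rw [List.getLast?_reverse, head?_arc] at hx
        rw [← hx.2, ← (head?_arc.1 hy).2]
        exact h1
      · intro c hc hc'
        obtain ⟨i, hi1, hi2, rfl⟩ := mem_arc.1 hc
        rw [List.mem_append, List.mem_reverse, mem_arc, mem_arc] at hc'
        rcases hc' with ⟨i', hi1', hi2', he⟩ | ⟨i', hi1', hi2', he⟩
        all_goals
          have := hd.inj _ _ he (by omega) (by omega)
          omega
      · intro x hx y hy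
        rw [List.head?_append, Option.mem_def, Option.or_eq_some_iff, List.head?_reverse] at hy
        rcases hy with hy | hy
        · rw [← (getLast?_arc.1 hx).2, ← (getLast?_arc.1 hy).2]
          convert h2.symm using 2
          push_cast; ring
        · have := (getLast?_arc (d := d) (a := p) (c := d (p + e - 1))).2 ⟨he, rfl⟩
          rw [hy.1] at this
          simp at this)
    (by
      simp only [List.mem_append, List.mem_reverse, mem_arc]
      rintro (⟨i, -, -, hi⟩ | ⟨i, -, -, hi⟩ | ⟨i, -, -, hi⟩) <;> exact hv i hi)
    (by simp; omega)
    (by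
      intro c hc
      rw [List.head?_append, Option.mem_def, Option.or_eq_some_iff] at hc
      rcases hc with hc | hc
      · exact (head?_arc.1 hc).2 ▸ hpe
      · have := (head?_arc (d := d) (a := p + e) (c := d (p + e))).2 ⟨Nat.succ_pos s, rfl⟩
        rw [hc.1] at this
        simp at this)
    (by
      intro c hc
      rw [← List.append_assoc, List.getLast?_append, Option.mem_def, Option.or_eq_some_iff] at hc
      rcases hc with hc | hc
      · rw [← (getLast?_arc.1 hc).2]
        convert hp using 1
        rw [← hper]
        congr 1
        push_cast; ring
      · have := (getLast?_arc (d := d) (a := p + e + s + 1)).2 ⟨Nat.succ_pos r, rfl⟩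
        rw [hc.1] at this
        simp at this)
    (by
      intro t ht
      obtain ⟨i, hi1, hi2, hi3, hi4⟩ := hd.exists_rep p t
      rw [← hi3, ← hi4] at ht ⊢
      rw [consec_append, consec_append, consec_reverse]
      by_cases hia : i = p + e - 1
      · subst hia
        rw [sub_add_cancel] at ht
        exact (ht.elim hpeY hXpe).elim
      by_cases hib : i = p + (e + s + 2 + r : ℕ) - 1
      · subst hib
        rw [hper, sub_add_cancel, hd.per] at ht
        exact (ht.elim hXp hpY).elim
      by_cases hic : i = p + e + s
      · subst hic
        exact (ht.elim hjY hjY').elim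
      by_cases h1 : i < p + e - 1
      · exact Or.inr (Or.inl (Or.inl (consec_arc hi1 (by omega))))
      by_cases h2 : i < p + e + s
      · exact Or.inl (consec_arc (by omega) (by omega))
      · exact Or.inr (Or.inl (Or.inr (Or.inl (consec_arc (by omega) (by omega))))))
  have := hmax l' hl'
  simp at hlen
  omega

/-- Data extracted from the hopping sets of a longest cycle `d` missing the vertex `v`. -/
structure IsHopPair (G : SimpleGraph V) (N : ℕ) (d : ℤ → V) (v : V) (X Y : Set V) : Prop where
  cycle : IsCycleFun G N d
  max : ∀ l, IsCycleList G l → l.length ≤ N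
  notMem : ∀ j, d j ≠ v
  hop : HopProp G d v Y X
  disj : ∀ x ∈ X, x ∉ Y
  X_mem : ∀ x ∈ X, ∃ j, d j = x
  adj_v : ∀ x, G.Adj v x → x ∈ X
  adj_Y : ∀ y ∈ Y, ∀ x, G.Adj y x → x ∈ X
  mem_Y : ∀ j, d j ∈ Y ↔ d (j - 1) ∈ X ∧ d (j + 1) ∈ X
  Y_mem : ∀ y ∈ Y, ∃ j, d j = y

theorem exists_isHopPair [Finite V] (hd : IsCycleFun G N d)
    (hmax : ∀ l, IsCycleList G l → l.length ≤ N) (hv : ∀ j, d j ≠ v)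
    (hdom : ∀ l, IsCycleList G l → l.length = N → ∀ a b, a ∉ l → b ∉ l → ¬ G.Adj a b) :
    ∃ X Y, IsHopPair G N d v X Y := by
  obtain ⟨n, hn⟩ := WellFoundedGT.monotone_chain_condition
    (⟨hopY G d v, hopY_mono⟩ : ℕ →o Set V)
  have hst : hopY G d v n = hopY G d v (n + 1) := hn (n + 1) (by omega)
  have hYj (i : ℕ) (j : ℤ) : d j ∈ hopY G d v (i + 1) ↔
      d (j - 1) ∈ hopX G d v i ∧ d (j + 1) ∈ hopX G d v i := by
    rw [mem_hopY_succ]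
    constructor
    · rintro ⟨j', h1, h2, h3⟩
      rw [hd.congr_add h1] at h3
      rw [sub_eq_add_neg, hd.congr_add h1] at h2
      exact ⟨h2, h3⟩
    · rintro ⟨h2, h3⟩
      exact ⟨j, rfl, h2, h3⟩
  have hcyc : ∀ j a, (∀ i, d i ≠ a) → a ∉ arc d j N := by
    intro j a ha hmem
    obtain ⟨i, hi⟩ := (mem_arc_full hd j).1 hmem
    exact ha i hi
  have h3 := hd.three_le
  have hYC : ∀ i, ∀ y ∈ hopY G d v i, (∃ j, d j = y) ∧ ∀ x, G.Adj y x → ∃ j, d j = x := by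
    intro i
    induction i with
    | zero => intro y hy; rw [hopY] at hy; exact hy.elim
    | succ i ih =>
      intro y hy
      by_cases hyi : y ∈ hopY G d v i
      · exact ih y hyi
      obtain ⟨j, rfl, h1, h2⟩ := mem_hopY_succ.1 hy
      refine ⟨⟨j, rfl⟩, fun z hz => ?_⟩
      by_contra hzC
      obtain ⟨hop, hdis, hdis'⟩ := hopProp_hop hd hmax hv i
      by_cases hzv : z = v
      · subst hzv
        exact hdis' _ (mem_hopX.2 (Or.inl hz.symm)) hy
      obtain ⟨l', hl', hlen, hmem⟩ := hop (arc d (j + 1) (N - 1)) (isPathList_arc hd (by omega))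
        (by rw [mem_arc]; rintro ⟨i, -, -, hi⟩; exact hv i hi) (by simp; omega)
        (by intro a ha; rw [← (head?_arc.1 ha).2]; exact h2)
        (by
          intro a ha
          rw [← (getLast?_arc.1 ha).2]
          convert h1 using 1
          rw [← hd.per (j - 1)]
          congr 1
          omega)
        (by
          intro t ht
          obtain ⟨t', ht1, ht2, ht3, ht4⟩ := hd.exists_rep j t
          rw [← ht3, ← ht4] at ht ⊢
          by_cases hA : t' = j
          · subst hA
            exact (ht.elim hyi (hdis _ h2)).elim
          by_cases hB : t' = j + N - 1
          · subst hB
            have e : d (j + N - 1) = d (j - 1) := by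
              rw [← hd.per (j - 1)]; congr 1; ring
            rw [e, sub_add_cancel, hd.per] at ht
            exact (ht.elim (hdis _ h1) hyi).elim
          exact consec_arc (by omega) (by omega))
      refine hdom l' hl' (by rw [hlen, length_arc]; omega) (d j) z ?_ ?_ hz
      · rw [hmem, mem_arc]
        rintro (h | ⟨t, ht1, ht2, ht⟩)
        · exact hv j h
        · have := hd.inj _ _ ht (by omega) (by omega)
          omega
      · rw [hmem, mem_arc]
        rintro (h | ⟨t, ht1, ht2, ht⟩)
        · exact hzv h
        · exact hzC ⟨t, ht⟩
  obtain ⟨hop, hdis, -⟩ := hopProp_hop hd hmax hv n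
  refine ⟨hopX G d v n, hopY G d v n, hd, hmax, hv, hop, hdis, ?_, ?_, ?_, ?_, ?_⟩
  · intro x hx
    rcases mem_hopX.1 hx with hx | ⟨y, hy, hyx⟩
    · by_contra hC
      push Not at hC
      exact hdom (arc d 0 N) (isCycleList_arc hd 0) (by simp) v x (hcyc 0 v hv) (hcyc 0 x hC) hx
    · exact (hYC n y hy).2 x hyx
  · exact fun x hx => mem_hopX.2 (Or.inl hx)
  · exact fun y hy x hx => mem_hopX.2 (Or.inr ⟨y, hy, hx⟩)
  · intro j
    rw [hst]
    exact hYj n j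
  · exact fun y hy => (hYC n y hy).1

namespace IsHopPair

variable {X Y : Set V}

theorem rev (h : IsHopPair G N d v X Y) : IsHopPair G N (fun j => d (-j)) v X Y where
  cycle := h.cycle.rev
  max := h.max
  notMem j := h.notMem (-j)
  hop := h.hop.rev
  disj := h.disj
  X_mem x hx := (h.X_mem x hx).imp' (- ·) fun j hj => by simpa using hj
  adj_v := h.adj_v
  adj_Y := h.adj_Y
  mem_Y j := by
    rw [h.mem_Y, and_comm, show -(j - 1) = -j + 1 by ring, show -(j + 1) = -j - 1 by ring]
  Y_mem y hy := (h.Y_mem y hy).imp' (- ·) fun j hj => by simpa using hj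

theorem not_mem_X_succ (h : IsHopPair G N d v X Y) {j : ℤ} (h1 : d j ∈ X) : d (j + 1) ∉ X :=
  fun h2 => h.hop.not_consecutive h.cycle h.max h.notMem h.disj j h1 h2

theorem not_adj_of_succ_mem (h : IsHopPair G N d v X Y) {a b : ℤ} (ha : d a ∉ Y) (hb : d b ∉ Y)
    (ha' : d (a + 1) ∈ X) (hb' : d (b + 1) ∈ X) : ¬ G.Adj (d a) (d b) :=
  h.hop.not_adj_of_succ_mem h.cycle h.max h.notMem h.disj a b ha hb ha' hb'

theorem not_common_neighbor_of_succ_mem (h : IsHopPair G N d v X Y) {a b : ℤ} (ha : d a ∉ Y)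
    (hb : d b ∉ Y) (ha' : d (a + 1) ∈ X) (hb' : d (b + 1) ∈ X) (hab : d a ≠ d b) {z : V}
    (hzv : z ≠ v) (hz : ∀ j, d j ≠ z) (hza : G.Adj z (d a)) : ¬ G.Adj z (d b) := fun hzb =>
  h.hop.not_isPathList_bridge h.cycle h.max h.notMem h.disj a b ha hb ha' hb' (m := [z])
    (by simpa using ⟨hzv, hz⟩)
    ⟨by simpa using ⟨hzb.symm, hza⟩, by simpa using ⟨⟨hzb.ne', hab.symm⟩, hza.ne⟩⟩

theorem not_adj_of_pred_mem (h : IsHopPair G N d v X Y) {a b : ℤ} (ha : d a ∉ Y) (hb : d b ∉ Y)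
    (ha' : d (a - 1) ∈ X) (hb' : d (b - 1) ∈ X) : ¬ G.Adj (d a) (d b) := by
  have := h.rev.not_adj_of_succ_mem (a := -a) (b := -b)
  simp only [neg_add, neg_neg] at this
  exact this ha hb ha' hb'

theorem not_common_neighbor_of_pred_mem (h : IsHopPair G N d v X Y) {a b : ℤ} (ha : d a ∉ Y)
    (hb : d b ∉ Y) (ha' : d (a - 1) ∈ X) (hb' : d (b - 1) ∈ X) (hab : d a ≠ d b) {z : V}
    (hzv : z ≠ v) (hz : ∀ j, d j ≠ z) (hza : G.Adj z (d a)) : ¬ G.Adj z (d b) := by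
  have := h.rev.not_common_neighbor_of_succ_mem (a := -a) (b := -b) (z := z)
  simp only [neg_add, neg_neg] at this
  exact this ha hb ha' hb' hab hzv (fun j => hz (-j)) hza

end IsHopPair

end Jackson

namespace Jackson

open Finset

variable {V : Type*} {G : SimpleGraph V} {N : ℕ} {d : ℤ → V} {v : V}

open scoped Classical in
/-- The number of neighbours of `a` in `B`. -/
noncomputable def degIn (G : SimpleGraph V) (a : V) (B : Finset V) : ℕ := #{b ∈ B | G.Adj a b}

theorem sum_degIn_comm (A B : Finset V) :
    ∑ a ∈ A, degIn G a B = ∑ b ∈ B, degIn G b A := by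
  classical
  have := Finset.sum_card_bipartiteAbove_eq_sum_card_bipartiteBelow G.Adj (s := A) (t := B)
  simp only [bipartiteAbove, bipartiteBelow] at this
  unfold degIn
  convert this using 4
  exact G.adj_comm _ _

theorem degIn_union [DecidableEq V] (a : V) (B C : Finset V) :
    degIn G a (B ∪ C) ≤ degIn G a B + degIn G a C := by
  classical
  unfold degIn
  rw [filter_union]
  exact card_union_le _ _

theorem degIn_union_of_disjoint [DecidableEq V] (a : V) {B C : Finset V} (h : Disjoint B C) :
    degIn G a (B ∪ C) = degIn G a B + degIn G a C := by
  classical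
  unfold degIn
  rw [filter_union, card_union_of_disjoint (disjoint_filter_filter h)]

theorem degIn_mono (a : V) {B C : Finset V} (h : B ⊆ C) : degIn G a B ≤ degIn G a C := by
  classical
  exact card_le_card (filter_subset_filter _ h)

theorem degIn_le_card (a : V) (B : Finset V) : degIn G a B ≤ #B := by
  classical
  exact card_filter_le _ _

theorem degIn_lt_card {a : V} {B : Finset V} (h : a ∈ B) : degIn G a B < #B := by
  classical
  exact card_lt_card ⟨filter_subset _ _, fun hc => by simpa using (hc h)⟩

theorem degIn_eq_zero {a : V} {B : Finset V} (h : ∀ b ∈ B, ¬ G.Adj a b) : degIn G a B = 0 := by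
  simpa [degIn, filter_eq_empty_iff] using h

theorem degIn_eq_of_forall {a : V} {B C : Finset V} (hBC : B ⊆ C)
    (h : ∀ c ∈ C, G.Adj a c → c ∈ B) : degIn G a B = degIn G a C := by
  unfold degIn
  congr 1
  ext c
  simp only [mem_filter]
  exact ⟨fun hc => ⟨hBC hc.1, hc.2⟩, fun hc => ⟨h c hc.1 hc.2, hc.2⟩⟩

theorem degIn_le_one {a : V} {B : Finset V}
    (h : ∀ b ∈ B, ∀ c ∈ B, G.Adj a b → G.Adj a c → b = c) : degIn G a B ≤ 1 := by
  rw [degIn, card_le_one]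
  simp only [mem_filter]
  exact fun b hb c hc => h b hb.1 c hc.1 hb.2 hc.2

theorem IsCycleFun.exists_shift (h : IsCycleFun G N d) (t : ℤ) :
    ∃ f : V → V, ∀ j, f (d j) = d (j + t) := by
  classical
  refine ⟨fun c => if hc : ∃ j, d j = c then d (hc.choose + t) else c, fun j => ?_⟩
  have hc : ∃ i, d i = d j := ⟨j, rfl⟩
  simp only [dif_pos hc]
  exact h.congr_add hc.choose_spec t

variable [Fintype V]

open scoped Classical in
/-- The cycle vertices outside `X` and `Y`. -/
noncomputable def hopR (d : ℤ → V) (X Y : Finset V) : Finset V :=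
  {c | ∃ j, d j = c ∧ d j ∉ X ∧ d j ∉ Y}

open scoped Classical in
/-- The cycle vertices outside `X` and `Y` that are followed by a vertex of `X`. -/
noncomputable def hopW (d : ℤ → V) (X Y : Finset V) : Finset V :=
  {c | ∃ j, d j = c ∧ d j ∉ X ∧ d j ∉ Y ∧ d (j + 1) ∈ X}

open scoped Classical in
/-- The cycle vertices outside `X` and `Y` that are preceded by a vertex of `X`. -/
noncomputable def hopU (d : ℤ → V) (X Y : Finset V) : Finset V :=
  {c | ∃ j, d j = c ∧ d j ∉ X ∧ d j ∉ Y ∧ d (j - 1) ∈ X}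

variable {X Y : Finset V}

theorem mem_hopR {c : V} : c ∈ hopR d X Y ↔ ∃ j, d j = c ∧ d j ∉ X ∧ d j ∉ Y := by simp [hopR]

theorem mem_hopW {c : V} : c ∈ hopW d X Y ↔ ∃ j, d j = c ∧ d j ∉ X ∧ d j ∉ Y ∧ d (j + 1) ∈ X := by
  simp [hopW]

theorem mem_hopU {c : V} : c ∈ hopU d X Y ↔ ∃ j, d j = c ∧ d j ∉ X ∧ d j ∉ Y ∧ d (j - 1) ∈ X := by
  simp [hopU]

theorem hopU_eq_hopW_rev : hopU d X Y = hopW (fun j => d (-j)) X Y := by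
  ext c
  rw [mem_hopU, mem_hopW]
  constructor
  · rintro ⟨j, h1, h2, h3, h4⟩
    exact ⟨-j, by simpa using h1, by simpa using h2, by simpa using h3, by
      rwa [show -(-j + 1) = j - 1 by ring]⟩
  · rintro ⟨j, h1, h2, h3, h4⟩
    exact ⟨-j, h1, h2, h3, by rwa [show -j - 1 = -(j + 1) by ring]⟩

namespace IsHopPair

theorem card_hopW (h : IsHopPair G N d v X Y) : #(hopW d X Y) + #Y = #X := by
  classical
  obtain ⟨pv, hpv⟩ := h.cycle.exists_shift (-1)
  have himg : X.image pv = hopW d X Y ∪ Y := by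
    ext c
    rw [mem_image, mem_union, mem_hopW]
    constructor
    · rintro ⟨x, hx, rfl⟩
      obtain ⟨j, rfl⟩ := h.X_mem x hx
      rw [hpv]
      by_cases hY : d (j + -1) ∈ Y
      · exact Or.inr hY
      · refine Or.inl ⟨j + -1, rfl, fun hX => ?_, hY, by simpa using hx⟩
        exact h.not_mem_X_succ (j := j + -1) hX (by simpa using hx)
    · rintro (⟨j, rfl, -, -, hj⟩ | hc)
      · exact ⟨_, hj, by rw [hpv]; simp⟩
      · obtain ⟨j, rfl⟩ := h.Y_mem c hc
        exact ⟨_, ((h.mem_Y j).1 hc).2, by rw [hpv]; simp⟩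
  rw [← card_union_of_disjoint, ← himg, card_image_of_injOn]
  · intro a ha b hb hab
    obtain ⟨i, rfl⟩ := h.X_mem a ha
    obtain ⟨j, rfl⟩ := h.X_mem b hb
    simp only [hpv] at hab
    simpa using h.cycle.congr_add hab 1
  · rw [disjoint_left]
    intro c hc
    obtain ⟨j, rfl, -, hY, -⟩ := mem_hopW.1 hc
    exact hY

theorem card_hopU (h : IsHopPair G N d v X Y) : #(hopU d X Y) + #Y = #X := by
  rw [hopU_eq_hopW_rev]
  exact h.rev.card_hopW

theorem exists_segment (h : IsHopPair G N d v X Y) {u : V} (hu : u ∈ hopU d X Y) :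
    ∃ (p : ℤ) (e : ℕ), d p = u ∧ 2 ≤ e ∧ e < N ∧ d (p - 1) ∈ X ∧ d (p + e) ∈ X ∧
      ∀ i, p ≤ i → i < p + e → d i ∉ X ∧ d i ∉ Y := by
  classical
  obtain ⟨p, rfl, hX, hY, hp⟩ := mem_hopU.1 hu
  have h3 := h.cycle.three_le
  have hex : ∃ e : ℕ, d (p + e) ∈ X := by
    refine ⟨N - 1, ?_⟩
    convert hp using 1
    rw [← h.cycle.per (p - 1)]
    congr 1
    omega
  have hmin : ∀ m < Nat.find hex, d (p + m) ∉ X := fun m hm => Nat.find_min hex hm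
  have hspec := Nat.find_spec hex
  have hle : Nat.find hex ≤ N - 1 := by
    refine Nat.find_min' hex ?_
    convert hp using 1
    rw [← h.cycle.per (p - 1)]
    congr 1
    omega
  generalize Nat.find hex = e at hmin hspec hle
  have h0 : e ≠ 0 := by
    rintro rfl
    exact hX (by simpa using hspec)
  have h1 : e ≠ 1 := by
    rintro rfl
    exact hY ((h.mem_Y p).2 ⟨hp, by simpa using hspec⟩)
  refine ⟨p, e, rfl, by omega, by omega, hp, hspec, fun i hi1 hi2 => ?_⟩
  obtain ⟨s, rfl⟩ : ∃ s : ℕ, i = p + s := ⟨(i - p).toNat, by omega⟩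
  refine ⟨hmin s (by omega), fun hiY => ?_⟩
  rcases Nat.eq_zero_or_pos s with rfl | hs
  · exact hY (by simpa using hiY)
  · apply hmin (s - 1) (by omega)
    have := ((h.mem_Y _).1 hiY).1
    rwa [show p + (s : ℤ) - 1 = p + (s - 1 : ℕ) by omega] at this

theorem segment_degree (h : IsHopPair G N d v X Y) {p : ℤ} {e : ℕ} (he : 2 ≤ e) (heN : e < N)
    (hp : d (p - 1) ∈ X) (hpe : d (p + e) ∈ X)
    (hseg : ∀ i, p ≤ i → i < p + e → d i ∉ X ∧ d i ∉ Y) :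
    degIn G (d p) (hopR d X Y) + degIn G (d (p + e - 1)) (hopR d X Y) + #(hopW d X Y) + 1 ≤
      #(hopR d X Y) + e := by
  classical
  set R := hopR d X Y
  set W := hopW d X Y
  set Q := (arc d p e).toFinset with hQ
  have hQc : #Q = e := by
    rw [hQ, List.toFinset_card_of_nodup (isPathList_arc h.cycle heN.le).nodup, length_arc]
  have memQ : ∀ c, c ∈ Q ↔ ∃ j, p ≤ j ∧ j < p + e ∧ d j = c := fun c => by
    rw [hQ, List.mem_toFinset, mem_arc]
  have hQR : Q ⊆ R := by
    intro c hc
    obtain ⟨j, h1, h2, rfl⟩ := (memQ c).1 hc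
    exact mem_hopR.2 ⟨j, rfl, hseg j h1 h2⟩
  have hWR : W ⊆ R := by
    intro c hc
    obtain ⟨j, rfl, h1, h2, -⟩ := mem_hopW.1 hc
    exact mem_hopR.2 ⟨j, rfl, h1, h2⟩
  have hRQ : R = Q ∪ (R \ Q) := by rw [union_sdiff_of_subset hQR]
  have hu : degIn G (d p) R ≤ (e - 1) + degIn G (d p) (R \ Q) := by
    conv_lhs => rw [hRQ]
    have := degIn_lt_card (G := G) (a := d p) (B := Q) ((memQ _).2 ⟨p, by omega, by omega, rfl⟩)
    have := degIn_union (G := G) (d p) Q (R \ Q)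
    omega
  have hw : degIn G (d (p + e - 1)) R ≤ (e - 1) + degIn G (d (p + e - 1)) (R \ Q) := by
    conv_lhs => rw [hRQ]
    have := degIn_lt_card (G := G) (a := d (p + e - 1)) (B := Q)
      ((memQ _).2 ⟨p + e - 1, by omega, by omega, rfl⟩)
    have := degIn_union (G := G) (d (p + e - 1)) Q (R \ Q)
    omega
  have hWQ : #(W ∩ Q) ≤ 1 := by
    have hsub : W ∩ Q ⊆ {d (p + e - 1)} := by
      intro c hc
      obtain ⟨hcW, hcQ⟩ := mem_inter.1 hc
      obtain ⟨j, h1, h2, rfl⟩ := (memQ c).1 hcQ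
      obtain ⟨i, hi, -, -, hi'⟩ := mem_hopW.1 hcW
      rw [h.cycle.congr_add hi] at hi'
      by_cases hj : j = p + e - 1
      · simp [hj]
      · exact absurd hi' (hseg (j + 1) (by omega) (by omega)).1
    simpa using card_le_card hsub
  have hfree : #((R \ Q) \ W) + #W + e ≤ #R + 1 := by
    have e1 : (R \ Q) \ W = R \ (Q ∪ W) := by rw [sdiff_sdiff_left]; rfl
    have e2 := card_sdiff_add_card_eq_card (union_subset hQR hWR)
    have e3 := card_union_add_card_inter Q W
    rw [inter_comm] at e3
    rw [e1]
    omega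
  obtain ⟨pv, hpv⟩ := h.cycle.exists_shift (-1)
  set A := {b ∈ R \ Q | G.Adj (d p) b} with hA
  set B := {b ∈ R \ Q | G.Adj (d (p + e - 1)) b} with hB
  have hpu := hseg p (by omega) (by omega)
  have hpw := hseg (p + e - 1) (by omega) (by omega)
  have hwX : d (p + e - 1 + 1) ∈ X := by simpa using hpe
  have hBsub : B ⊆ (R \ Q) \ W := by
    intro b hb
    obtain ⟨hb1, hb2⟩ := mem_filter.1 hb
    refine mem_sdiff.2 ⟨hb1, fun hbW => ?_⟩
    obtain ⟨j, rfl, h1, h2, h3⟩ := mem_hopW.1 hbW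
    exact h.not_adj_of_succ_mem (by simpa using hpw.2) (by simpa using h2) (by simpa using hwX)
      (by simpa using h3) hb2
  have hper : d (p + N - 1) = d (p - 1) := by
    rw [← h.cycle.per (p - 1)]; congr 1; ring
  have hAj : ∀ a ∈ A, ∃ j, p + e ≤ j ∧ j + 1 ≤ p + N - 1 ∧ d (j + 1) = a ∧ d j ∉ X ∧ d j ∉ Y ∧
      d (j + 1) ∉ X ∧ d (j + 1) ∉ Y ∧ G.Adj (d p) a := by
    intro a ha
    obtain ⟨ha1, ha2⟩ := mem_filter.1 ha
    obtain ⟨haR, haQ⟩ := mem_sdiff.1 ha1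
    obtain ⟨i, rfl, hi1, hi2⟩ := mem_hopR.1 haR
    obtain ⟨j, hj1, hj2, hj3, hj4⟩ := h.cycle.exists_rep p (i - 1)
    have hj5 := hj4 1
    rw [sub_add_cancel] at hj5
    have hjX : d j ∉ X := by
      intro hjX
      exact h.not_adj_of_pred_mem (by simpa using hpu.2) (by simpa using hi2) (by simpa using hp)
        (by rw [← hj3]; simpa using hjX) ha2
    have hjN : j ≠ p + N - 1 := by
      rintro rfl
      exact hjX (hper ▸ hp)
    refine ⟨j, ?_, by omega, hj5, hjX, ?_, hj5 ▸ hi1, hj5 ▸ hi2, ha2⟩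
    · by_contra hlt
      by_cases hj : j = p + e - 1
      · subst hj
        exact hi1 (hj5 ▸ hwX)
      · exact haQ ((memQ _).2 ⟨j + 1, by omega, by omega, hj5⟩)
    · intro hjY
      exact hi1 (hj5 ▸ ((h.mem_Y j).1 hjY).2)
  have hAsub : A.image pv ⊆ (R \ Q) \ W := by
    intro c hc
    obtain ⟨a, ha, rfl⟩ := mem_image.1 hc
    obtain ⟨j, hj1, hj2, rfl, hjX, hjY, hjX', hjY', -⟩ := hAj a ha
    rw [hpv, add_neg_cancel_right]
    refine mem_sdiff.2 ⟨mem_sdiff.2 ⟨mem_hopR.2 ⟨j, rfl, hjX, hjY⟩, fun hjQ => ?_⟩, fun hjW => ?_⟩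
    · obtain ⟨i, hi1, hi2, hi⟩ := (memQ _).1 hjQ
      have := h.cycle.inj _ _ hi (by omega) (by omega)
      omega
    · obtain ⟨i, hi, -, -, hi'⟩ := mem_hopW.1 hjW
      rw [h.cycle.congr_add hi] at hi'
      exact hjX' hi'
  have hdisj : Disjoint (A.image pv) B := by
    rw [disjoint_left]
    intro c hc hcB
    obtain ⟨a, ha, rfl⟩ := mem_image.1 hc
    obtain ⟨j, hj1, hj2, rfl, hjX, hjY, hjX', hjY', hadj⟩ := hAj a ha
    rw [hpv, add_neg_cancel_right] at hcB
    exact h.hop.not_insert_segment h.cycle h.max h.notMem h.disj (by omega) hp hpe hpu.2 hpw.2 hj1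
      hj2 hjY hjY' hadj (mem_filter.1 hcB).2
  have hcardA : #(A.image pv) = #A := by
    refine card_image_of_injOn fun a ha b hb hab => ?_
    obtain ⟨i, -, -, rfl, -⟩ := hAj a ha
    obtain ⟨j, -, -, rfl, -⟩ := hAj b hb
    simp only [hpv, add_neg_cancel_right] at hab
    exact h.cycle.congr_add hab 1
  have htot : #A + #B ≤ #((R \ Q) \ W) := by
    rw [← hcardA, ← card_union_of_disjoint hdisj]
    exact card_le_card (union_subset hAsub hBsub)
  have eA : degIn G (d p) (R \ Q) = #A := by unfold degIn; congr
  have eB : degIn G (d (p + e - 1)) (R \ Q) = #B := by unfold degIn; congr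
  omega

/-- In a `k`-regular graph on at most `3k` vertices there is no hop pair. -/
theorem false_of_regular (h : IsHopPair G N d v X Y) {k : ℕ} (hreg : ∀ a, degIn G a univ = k)
    (hk : Fintype.card V ≤ 3 * k) : False := by
  classical
  set R := hopR d X Y with hR
  set W := hopW d X Y with hW
  set U := hopU d X Y with hU
  set O : Finset V := {c | c ≠ v ∧ ∀ j, d j ≠ c} with hO
  have hcW : #W + #Y = #X := h.card_hopW
  have hcU : #U + #Y = #X := h.card_hopU
  have hvX : v ∉ X := fun hv => (h.X_mem v hv).elim fun j hj => h.notMem j hj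
  have hvY : v ∉ Y := fun hv => (h.Y_mem v hv).elim fun j hj => h.notMem j hj
  have hXY : Disjoint X Y := disjoint_left.2 h.disj
  have hRX : Disjoint X R := by
    rw [disjoint_right]
    intro c hc
    obtain ⟨j, rfl, h1, h2⟩ := mem_hopR.1 hc
    exact h1
  have hRY : Disjoint Y R := by
    rw [disjoint_right]
    intro c hc
    obtain ⟨j, rfl, h1, h2⟩ := mem_hopR.1 hc
    exact h2
  have hOX : Disjoint X O := by
    rw [disjoint_left]
    intro c hc hcO
    obtain ⟨j, hj⟩ := h.X_mem c hc
    exact (mem_filter.1 hcO).2.2 j hj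
  have hOY : Disjoint Y O := by
    rw [disjoint_left]
    intro c hc hcO
    obtain ⟨j, hj⟩ := h.Y_mem c hc
    exact (mem_filter.1 hcO).2.2 j hj
  have hOR : Disjoint R O := by
    rw [disjoint_left]
    intro c hc hcO
    obtain ⟨j, hj, -⟩ := mem_hopR.1 hc
    exact (mem_filter.1 hcO).2.2 j hj
  have hvR : v ∉ R := fun hv => by
    obtain ⟨j, hj, -⟩ := mem_hopR.1 hv
    exact h.notMem j hj
  have hvO : v ∉ O := fun hv => (mem_filter.1 hv).2.1 rfl
  have huniv : (univ : Finset V) = (X ∪ R ∪ O) ∪ insert v Y := by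
    ext c
    simp only [mem_univ, mem_union, mem_insert, true_iff]
    by_cases hcv : c = v
    · tauto
    by_cases hcX : c ∈ X
    · tauto
    by_cases hcY : c ∈ Y
    · tauto
    by_cases hcC : ∃ j, d j = c
    · obtain ⟨j, rfl⟩ := hcC
      exact Or.inl (Or.inl (Or.inr (mem_hopR.2 ⟨j, rfl, hcX, hcY⟩)))
    · push Not at hcC
      exact Or.inl (Or.inr (by simp [hO, hcv, hcC]))
  have hd1 : Disjoint (X ∪ R ∪ O) (insert v Y) := by
    rw [disjoint_insert_right, disjoint_union_left, disjoint_union_left]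
    refine ⟨?_, ⟨hXY, hRY.symm⟩, hOY.symm⟩
    simp only [mem_union]
    tauto
  have hd2 : Disjoint (X ∪ R) O := disjoint_union_left.2 ⟨hOX, hOR⟩
  have hcard : #X + #R + #O + (#Y + 1) ≤ 3 * k := by
    rw [← card_insert_of_notMem hvY, ← card_union_of_disjoint hRX, ← card_union_of_disjoint hd2,
      ← card_union_of_disjoint hd1, ← huniv]
    exact hk
  have hYX : ∀ y ∈ insert v Y, degIn G y X = k := by
    intro y hy
    rw [← hreg y]
    refine degIn_eq_of_forall (subset_univ _) fun c _ hc => ?_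
    rcases mem_insert.1 hy with rfl | hy
    · exact h.adj_v c hc
    · exact h.adj_Y y hy c hc
  have hkX : k ≤ #X := by
    rw [← hYX v (mem_insert_self _ _)]
    exact degIn_le_card _ _
  have hUW : Disjoint U W := by
    rw [disjoint_left]
    intro c hcU hcW
    obtain ⟨i, rfl, -, hiY, hi⟩ := mem_hopU.1 hcU
    obtain ⟨j, hj, -, -, hj'⟩ := mem_hopW.1 hcW
    rw [h.cycle.congr_add hj] at hj'
    exact hiY ((h.mem_Y i).2 ⟨hi, hj'⟩)
  have hUR : U ⊆ R := by
    intro c hc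
    obtain ⟨j, rfl, h1, h2, -⟩ := mem_hopU.1 hc
    exact mem_hopR.2 ⟨j, rfl, h1, h2⟩
  have hWR : W ⊆ R := by
    intro c hc
    obtain ⟨j, rfl, h1, h2, -⟩ := mem_hopW.1 hc
    exact mem_hopR.2 ⟨j, rfl, h1, h2⟩
  have hdegR : ∀ c ∈ R, degIn G c X + degIn G c R + degIn G c O = k := by
    intro c hc
    rw [← hreg c, huniv, degIn_union_of_disjoint c hd1, degIn_union_of_disjoint c hd2,
      degIn_union_of_disjoint c hRX, degIn_eq_zero (B := insert v Y), add_zero]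
    intro y hy hcy
    refine disjoint_right.1 hRX hc ?_
    rcases mem_insert.1 hy with rfl | hy
    · exact h.adj_v c hcy.symm
    · exact h.adj_Y y hy c hcy.symm
  have hXsum : ∑ c ∈ U, degIn G c X + ∑ c ∈ W, degIn G c X + (#Y + 1) * k ≤ #X * k := by
    have e1 : ∑ c ∈ insert v Y, degIn G c X = (#Y + 1) * k := by
      rw [sum_congr rfl hYX, sum_const, card_insert_of_notMem hvY, smul_eq_mul]
    have e2 : Disjoint (U ∪ W) (insert v Y) := by
      rw [disjoint_insert_right]
      refine ⟨fun hv => hvR (union_subset hUR hWR hv), ?_⟩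
      exact disjoint_of_subset_left (union_subset hUR hWR) hRY.symm
    rw [← e1, ← sum_union hUW, ← sum_union e2, sum_degIn_comm]
    refine sum_le_card_nsmul _ _ _ fun x _ => ?_
    rw [← hreg x]
    exact degIn_mono _ (subset_univ _)
  have hOU : ∑ c ∈ U, degIn G c O ≤ #O := by
    rw [sum_degIn_comm]
    have : ∀ z ∈ O, degIn G z U ≤ 1 := by
      intro z hz
      obtain ⟨-, hzv, hzC⟩ := mem_filter.1 hz
      refine degIn_le_one fun b hb c hc hzb hzc => ?_
      obtain ⟨i, rfl, -, hiY, hi⟩ := mem_hopU.1 hb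
      obtain ⟨j, rfl, -, hjY, hj⟩ := mem_hopU.1 hc
      by_contra hne
      exact h.not_common_neighbor_of_pred_mem (by simpa using hiY) (by simpa using hjY) hi hj hne
        hzv hzC hzb hzc
    simpa using sum_le_card_nsmul _ _ _ this
  have hOW : ∑ c ∈ W, degIn G c O ≤ #O := by
    rw [sum_degIn_comm]
    have : ∀ z ∈ O, degIn G z W ≤ 1 := by
      intro z hz
      obtain ⟨-, hzv, hzC⟩ := mem_filter.1 hz
      refine degIn_le_one fun b hb c hc hzb hzc => ?_
      obtain ⟨i, rfl, -, hiY, hi⟩ := mem_hopW.1 hb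
      obtain ⟨j, rfl, -, hjY, hj⟩ := mem_hopW.1 hc
      by_contra hne
      exact h.not_common_neighbor_of_succ_mem (by simpa using hiY) (by simpa using hjY) hi hj hne
        hzv hzC hzb hzc
    simpa using sum_le_card_nsmul _ _ _ this
  have hRsum : ∑ c ∈ U, degIn G c R + ∑ c ∈ W, degIn G c R + #U * (#U + 1) ≤
      (#U + 1) * #R := by
    have hseg : ∀ u, ∃ (p : ℤ) (e : ℕ), u ∈ U → d p = u ∧ 2 ≤ e ∧ e < N ∧ d (p - 1) ∈ X ∧
        d (p + e) ∈ X ∧ ∀ i, p ≤ i → i < p + e → d i ∉ X ∧ d i ∉ Y := by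
      intro u
      by_cases hu : u ∈ U
      · obtain ⟨p, e, hpe⟩ := h.exists_segment hu
        exact ⟨p, e, fun _ => hpe⟩
      · exact ⟨0, 0, fun hu' => absurd hu' hu⟩
    choose p e hpe using hseg
    have hdisQ : ∀ u ∈ U, ∀ u' ∈ U, ∀ i i', p u ≤ i → i < p u + e u → p u' ≤ i' →
        i' < p u' + e u' → d i = d i' → i - p u ≤ i' - p u' → u = u' := by
      intro u hu u' hu' i i' h1 h2 h3 h4 hii hle
      obtain ⟨hp, -, -, hpX, -, -⟩ := hpe u hu
      obtain ⟨hp', -, -, -, -, hs⟩ := hpe u' hu'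
      have e1 := h.cycle.congr_add hii (p u - i)
      have e2 := h.cycle.congr_add hii (p u - i - 1)
      rw [add_sub_cancel] at e1
      rw [show i + (p u - i - 1) = p u - 1 by ring] at e2
      by_cases heq : i - p u = i' - p u'
      · rw [← hp, ← hp', e1]
        congr 1
        omega
      · exact absurd (e2 ▸ hpX) (hs _ (by omega) (by omega)).1
    have hdisQ' : ∀ u ∈ U, ∀ u' ∈ U, ∀ i i', p u ≤ i → i < p u + e u → p u' ≤ i' →
        i' < p u' + e u' → d i = d i' → u = u' := by
      intro u hu u' hu' i i' h1 h2 h3 h4 hii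
      rcases le_total (i - p u) (i' - p u') with hle | hle
      · exact hdisQ u hu u' hu' i i' h1 h2 h3 h4 hii hle
      · exact (hdisQ u' hu' u hu i' i h3 h4 h1 h2 hii.symm hle).symm
    have hwinj : Set.InjOn (fun u => d (p u + e u - 1)) U := by
      intro u hu u' hu' huu
      have := (hpe u hu).2.1
      have := (hpe u' hu').2.1
      exact hdisQ' u hu u' hu' _ _ (by omega) (by omega) (by omega) (by omega) huu
    have hWimg : U.image (fun u => d (p u + e u - 1)) = W := by
      refine eq_of_subset_of_card_le (fun c hc => ?_) ?_
      · obtain ⟨u, hu, rfl⟩ := mem_image.1 hc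
        obtain ⟨-, h2, -, -, h3, hs⟩ := hpe u hu
        obtain ⟨h4, h5⟩ := hs (p u + e u - 1) (by omega) (by omega)
        exact mem_hopW.2 ⟨_, rfl, h4, h5, by simpa using h3⟩
      · rw [card_image_of_injOn hwinj]
        omega
    have hsumW : ∑ c ∈ W, degIn G c R = ∑ u ∈ U, degIn G (d (p u + e u - 1)) R := by
      rw [← hWimg, sum_image hwinj]
    have hQsum : ∑ u ∈ U, e u ≤ #R := by
      have e1 : ∀ u ∈ U, #(arc d (p u) (e u)).toFinset = e u := by
        intro u hu
        rw [List.toFinset_card_of_nodup (isPathList_arc h.cycle (hpe u hu).2.2.1.le).nodup,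
          length_arc]
      rw [← sum_congr rfl e1, ← card_biUnion]
      · refine card_le_card (biUnion_subset.2 fun u hu c hc => ?_)
        obtain ⟨j, h1, h2, rfl⟩ := mem_arc.1 (List.mem_toFinset.1 hc)
        exact mem_hopR.2 ⟨j, rfl, (hpe u hu).2.2.2.2.2 j h1 h2⟩
      · intro u hu u' hu' hne
        rw [Function.onFun, disjoint_left]
        intro c hc hc'
        obtain ⟨i, h1, h2, rfl⟩ := mem_arc.1 (List.mem_toFinset.1 hc)
        obtain ⟨j, h3, h4, hj⟩ := mem_arc.1 (List.mem_toFinset.1 hc')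
        exact hne (hdisQ' u hu u' hu' i j h1 h2 h3 h4 hj.symm)
    have hper : ∀ u ∈ U, degIn G u R + degIn G (d (p u + e u - 1)) R + (#U + 1) ≤ #R + e u := by
      intro u hu
      obtain ⟨h1, h2, h3, h4, h5, h6⟩ := hpe u hu
      have := h.segment_degree h2 h3 h4 h5 h6
      rw [h1, ← hR, ← hW] at this
      have : #U = #W := by omega
      omega
    have := sum_le_sum hper
    simp only [sum_add_distrib, sum_const, smul_eq_mul] at this
    rw [hsumW]
    linarith
  have hUsum : ∑ c ∈ U, degIn G c X + ∑ c ∈ U, degIn G c R + ∑ c ∈ U, degIn G c O = #U * k := by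
    rw [← sum_add_distrib, ← sum_add_distrib, sum_congr rfl fun c hc => hdegR c (hUR hc),
      sum_const, smul_eq_mul]
  have hWsum : ∑ c ∈ W, degIn G c X + ∑ c ∈ W, degIn G c R + ∑ c ∈ W, degIn G c O = #W * k := by
    rw [← sum_add_distrib, ← sum_add_distrib, sum_congr rfl fun c hc => hdegR c (hWR hc),
      sum_const, smul_eq_mul]
  have hWU : #W = #U := by omega
  rw [hWU] at hWsum
  have hk0 : 0 < k := by omega
  generalize #U = t at *
  have ht : 1 ≤ t := by
    have hle : (#Y + 1) * k ≤ #X * k := by omega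
    have := Nat.le_of_mul_le_mul_right hle hk0
    omega
  rw [← hcU] at hXsum
  have hmain : (t + 1) * k + t * (t + 1) ≤ (t + 1) * #R + (t + 1) * #O := by
    have : 2 * #O ≤ (t + 1) * #O := Nat.mul_le_mul_right _ (by omega)
    nlinarith
  have hfin : k + t ≤ #R + #O := by
    have hle : (t + 1) * (k + t) ≤ (t + 1) * (#R + #O) := by linarith
    exact Nat.le_of_mul_le_mul_left hle (by omega)
  omega

end IsHopPair

end Jackson

namespace Jackson

open Finset

variable {V : Type*} {G : SimpleGraph V}

/-- `M` is a union of components of the subgraph induced on `K`. -/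
structure ClosedIn (G : SimpleGraph V) (K M : Finset V) : Prop where
  subset : M ⊆ K
  mem_of_adj : ∀ a ∈ M, ∀ b ∈ K, G.Adj a b → b ∈ M

/-- The subgraph induced on `K` has at most one component. -/
def ConnIn (G : SimpleGraph V) (K : Finset V) : Prop :=
  ∀ M, ClosedIn G K M → M.Nonempty → M = K

theorem ClosedIn.refl (K : Finset V) : ClosedIn G K K := ⟨subset_rfl, fun _ _ _ h _ => h⟩

theorem ClosedIn.trans {K M L : Finset V} (h₁ : ClosedIn G K M) (h₂ : ClosedIn G M L) :
    ClosedIn G K L :=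
  ⟨h₂.subset.trans h₁.subset, fun a ha b hb hab =>
    h₂.mem_of_adj a ha b (h₁.mem_of_adj a (h₂.subset ha) b hb hab) hab⟩

/-- Every nonempty vertex set contains a component. -/
theorem exists_connIn_closedIn {K : Finset V} (hK : K.Nonempty) :
    ∃ L, ClosedIn G K L ∧ L.Nonempty ∧ ConnIn G L := by
  classical
  have hex : ∃ n, ∃ L, ClosedIn G K L ∧ L.Nonempty ∧ #L = n :=
    ⟨_, K, ClosedIn.refl K, hK, rfl⟩
  obtain ⟨L, h1, h2, h3⟩ := Nat.find_spec hex
  refine ⟨L, h1, h2, fun M hM hne => eq_of_subset_of_card_le hM.subset ?_⟩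
  rw [h3]
  exact Nat.find_min' hex ⟨M, h1.trans hM, hne, rfl⟩

variable [DecidableEq V]

theorem ClosedIn.sdiff {K M : Finset V} (h : ClosedIn G K M) : ClosedIn G K (K \ M) :=
  ⟨sdiff_subset, fun a ha b hb hab => mem_sdiff.2 ⟨hb, fun hbM =>
    (mem_sdiff.1 ha).2 (h.mem_of_adj b hbM a (mem_sdiff.1 ha).1 hab.symm)⟩⟩

/-- The component of the subgraph induced on `K` containing `a`. -/
theorem exists_connIn_closedIn_mem {K : Finset V} {a : V} (ha : a ∈ K) :
    ∃ L, ClosedIn G K L ∧ a ∈ L ∧ ConnIn G L := by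
  classical
  have hex : ∃ n, ∃ L, ClosedIn G K L ∧ a ∈ L ∧ #L = n := ⟨_, K, ClosedIn.refl K, ha, rfl⟩
  obtain ⟨L, h1, h2, h3⟩ := Nat.find_spec hex
  have key : ∀ M, ClosedIn G L M → a ∈ M → M = L := by
    intro M hM haM
    refine eq_of_subset_of_card_le hM.subset ?_
    rw [h3]
    exact Nat.find_min' hex ⟨M, h1.trans hM, haM, rfl⟩
  refine ⟨L, h1, h2, fun M hM hne => ?_⟩
  by_cases haM : a ∈ M
  · exact key M hM haM
  · have := key _ hM.sdiff (mem_sdiff.2 ⟨h2, haM⟩)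
    obtain ⟨b, hb⟩ := hne
    have hbL := hM.subset hb
    rw [← this] at hbL
    exact absurd hb (mem_sdiff.1 hbL).2

theorem ClosedIn.exists_adj {K M : Finset V} {v : V} (hK : ConnIn G K) (hv : v ∈ K)
    (h : ClosedIn G (K.erase v) M) (hM : M.Nonempty) : ∃ z ∈ M, G.Adj v z := by
  by_contra hno
  push Not at hno
  have hvM : v ∉ M := fun hvM => by simpa using h.subset hvM
  have hcl : ClosedIn G K M := ⟨h.subset.trans (erase_subset _ _), fun a ha b hb hab => by
    by_cases hbv : b = v
    · exact absurd hab.symm (hbv ▸ hno a ha)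
    · exact h.mem_of_adj a ha b (mem_erase.2 ⟨hbv, hb⟩) hab⟩
  exact hvM (hK M hcl hM ▸ hv)

/-- A component of `M - w` without neighbours of `v`, where `M` is a union of components of
`K - v`, is a union of components of `K - w`. -/
theorem ClosedIn.erase_of_not_adj {K M L : Finset V} {v w : V} (h : ClosedIn G (K.erase v) M)
    (hL : ClosedIn G (M.erase w) L) (hno : ∀ z ∈ L, ¬ G.Adj v z) : ClosedIn G (K.erase w) L := by
  have hLM : L ⊆ M := hL.subset.trans (erase_subset _ _)
  refine ⟨fun a ha => mem_erase.2 ⟨?_, ?_⟩, fun a ha b hb hab => ?_⟩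
  · exact (mem_erase.1 (hL.subset ha)).1
  · exact (mem_erase.1 (h.subset (hLM ha))).2
  · have hbv : b ≠ v := fun hbv => hno a ha (hbv ▸ hab.symm)
    refine hL.mem_of_adj a ha b (mem_erase.2 ⟨(mem_erase.1 hb).1, ?_⟩) hab
    exact h.mem_of_adj a (hLM ha) b (mem_erase.2 ⟨hbv, (mem_erase.1 hb).2⟩) hab

open scoped Classical in
theorem ClosedIn.degIn_le {K M : Finset V} {v z : V} (h : ClosedIn G (K.erase v) M) (hz : z ∈ M) :
    degIn G z K ≤ degIn G z M + if G.Adj v z then 1 else 0 := by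
  have hsub : {b ∈ K | G.Adj z b} ⊆ {b ∈ M | G.Adj z b} ∪ {b ∈ ({v} : Finset V) | G.Adj z b} := by
    intro b hb
    obtain ⟨hbK, hzb⟩ := mem_filter.1 hb
    by_cases hbv : b = v
    · exact mem_union_right _ (mem_filter.2 ⟨by simp [hbv], hzb⟩)
    · exact mem_union_left _
        (mem_filter.2 ⟨h.mem_of_adj z hz b (mem_erase.2 ⟨hbv, hbK⟩) hzb, hzb⟩)
  refine (card_le_card hsub).trans ((card_union_le _ _).trans (Nat.add_le_add_left ?_ _))
  rw [filter_singleton, G.adj_comm z v]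
  split_ifs <;> simp

/-- In a connected set any two vertices are joined by a path. -/
theorem ConnIn.exists_path {K : Finset V} (hK : ConnIn G K) {v t : V} (hv : v ∈ K) (ht : t ∈ K) :
    ∃ l, IsPathList G l ∧ (∀ a ∈ l, a ∈ K) ∧ v ∈ l.head? ∧ t ∈ l.getLast? := by
  classical
  set S := {t ∈ K | ∃ l, IsPathList G l ∧ (∀ a ∈ l, a ∈ K) ∧ v ∈ l.head? ∧ t ∈ l.getLast?} with hS
  have hvS : v ∈ S := mem_filter.2 ⟨hv, [v], isPathList_singleton v, by simpa using hv, by simp⟩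
  have hcl : ClosedIn G K S := by
    refine ⟨filter_subset _ _, fun a ha b hb hab => mem_filter.2 ⟨hb, ?_⟩⟩
    obtain ⟨-, l, hl, hlK, hh, hla⟩ := mem_filter.1 ha
    by_cases hbl : b ∈ l
    · obtain ⟨s, r, rfl⟩ := List.append_of_mem hbl
      refine ⟨s ++ [b], ?_, ?_, ?_, by simp⟩
      · rw [← List.singleton_append, ← List.append_assoc, isPathList_append] at hl
        exact hl.1
      · intro c hc
        exact hlK c (by simp at hc ⊢; tauto)
      · cases s <;> simpa using hh
    · refine ⟨l ++ [b], hl.append (isPathList_singleton b) ?_ ?_, ?_, ?_, by simp⟩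
      · intro c hc hcb
        simp at hcb
        exact hbl (hcb ▸ hc)
      · intro c hc e he
        simp at he
        rw [Option.mem_unique hc hla, ← he]
        exact hab
      · intro c hc
        rcases List.mem_append.1 hc with hc | hc
        · exact hlK c hc
        · simp at hc
          exact hc ▸ hb
      · rw [List.head?_append, Option.mem_def.1 hh]
        rfl
  have := hK S hcl ⟨v, hvS⟩
  rw [← this] at ht
  exact (mem_filter.1 ht).2

open scoped Classical in
/-- An Erdős–Gallai type lemma: a long path from `X` to `T` inside a connected set all of whose
end blocks meet `X ∪ T`. -/
theorem exists_long_path (n : ℕ) : ∀ (K : Finset V) (X T : Set V) (r : ℕ), #K ≤ n → K.Nonempty →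
    ConnIn G K → (∃ a ∈ K, a ∈ X) → (∃ a ∈ K, a ∈ T) →
    (∀ v ∈ K, ∀ M, ClosedIn G (K.erase v) M → M.Nonempty → ∃ a ∈ M, a ∈ X ∨ a ∈ T) →
    (∀ a ∈ K, r ≤ degIn G a K + (if a ∈ X then 1 else 0) + (if a ∈ T then 1 else 0)) →
    ∃ l, IsPathList G l ∧ (∀ a ∈ l, a ∈ K) ∧ l ≠ [] ∧ (∀ a ∈ l.head?, a ∈ X) ∧
      (∀ a ∈ l.getLast?, a ∈ T) ∧ r ≤ l.length + 1 := by
  induction n with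
  | zero =>
    intro K X T r hn hne
    exact absurd (card_pos.2 hne) (by omega)
  | succ n ih =>
    intro K X T r hn hne hconn hX hT h2 hdeg
    by_cases hcase : ∃ v ∈ K, ∃ M, ClosedIn G (K.erase v) M ∧ M.Nonempty ∧ ∀ a ∈ M, a ∉ T
    · obtain ⟨v, hv, M₀, hM₀, hne₀, hMT₀⟩ := hcase
      obtain ⟨M, hMM₀, hMne, hMconn⟩ := exists_connIn_closedIn (G := G) hne₀
      have hM := hM₀.trans hMM₀
      have hMT : ∀ a ∈ M, a ∉ T := fun a ha => hMT₀ a (hMM₀.subset ha)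
      have hvM : v ∉ M := fun hvM => by simpa using hM.subset hvM
      have hMK : M ⊆ K := hM.subset.trans (erase_subset _ _)
      obtain ⟨l, hl, hlM, hl0, hlX, hlv, hlr⟩ := ih M X {z | G.Adj v z} r
        (by
          have := card_lt_card ⟨hMK, fun hKM => hvM (hKM hv)⟩
          omega) hMne hMconn
        (by
          obtain ⟨a, ha, haX⟩ := h2 v hv M hM hMne
          exact ⟨a, ha, haX.resolve_right (hMT a ha)⟩)
        (hM.exists_adj hconn hv hMne)
        (by
          intro w hw L hL hLne
          by_contra hno
          push Not at hno
          obtain ⟨a, ha, haX⟩ := h2 w (hMK hw) L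
            (hM.erase_of_not_adj hL fun z hz => (hno z hz).2) hLne
          refine haX.elim (hno a ha).1 (hMT a ?_)
          exact erase_subset _ _ (hL.subset ha))
        (by
          intro a ha
          have h1 := hdeg a (hMK ha)
          rw [if_neg (hMT a ha)] at h1
          have h3 := hM.degIn_le ha
          simp only [Set.mem_ofPred_eq]
          omega)
      obtain ⟨t, ht, htT⟩ := hT
      have hcl : ∀ L, ClosedIn G (K \ M) L → L.Nonempty → v ∈ L := by
        intro L hL hLne
        by_contra hvL
        have : ClosedIn G K L := by
          refine ⟨hL.subset.trans sdiff_subset, fun a ha b hb hab => ?_⟩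
          refine hL.mem_of_adj a ha b (mem_sdiff.2 ⟨hb, fun hbM => ?_⟩) hab
          obtain ⟨haK, haM⟩ := mem_sdiff.1 (hL.subset ha)
          refine haM (hM.mem_of_adj b hbM a (mem_erase.2 ⟨?_, haK⟩) hab.symm)
          rintro rfl
          exact hvL ha
        exact hvL (hconn L this hLne ▸ hv)
      have hKM : ConnIn G (K \ M) := by
        intro L hL hLne
        refine hL.subset.antisymm fun a ha => ?_
        by_contra haL
        have := hcl _ hL.sdiff ⟨a, mem_sdiff.2 ⟨ha, haL⟩⟩
        exact (mem_sdiff.1 this).2 (hcl L hL hLne)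
      obtain ⟨l', hl', hlK', hh', ht'⟩ := hKM.exists_path (v := v) (t := t)
        (mem_sdiff.2 ⟨hv, hvM⟩) (mem_sdiff.2 ⟨ht, fun h => hMT t h htT⟩)
      refine ⟨l ++ l', hl.append hl' ?_ ?_, ?_, by simp [hl0], ?_, ?_, by simp; omega⟩
      · exact fun a ha ha' => (mem_sdiff.1 (hlK' a ha')).2 (hlM a ha)
      · intro a ha b hb
        rw [Option.mem_unique hb hh']
        exact (hlv a ha).symm
      · intro a ha
        rcases List.mem_append.1 ha with ha | ha
        · exact hMK (hlM a ha)
        · exact (mem_sdiff.1 (hlK' a ha)).1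
      · intro a ha
        rw [List.head?_append_of_ne_nil _ hl0] at ha
        exact hlX a ha
      · intro a ha
        rw [List.getLast?_append, Option.mem_def.1 ht'] at ha
        simp at ha
        exact ha ▸ htT
    · push Not at hcase
      obtain ⟨x, hx, hxX⟩ := hX
      by_cases hK1 : (K.erase x).Nonempty
      · obtain ⟨L, hL, hLne, hLconn⟩ := exists_connIn_closedIn (G := G) hK1
        have hxL : x ∉ L := fun hxL => by simpa using hL.subset hxL
        have hLK : L ⊆ K := hL.subset.trans (erase_subset _ _)
        obtain ⟨l, hl, hlL, hl0, hlX, hlT, hlr⟩ := ih L {z | G.Adj x z} T (r - 1)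
          (by
            have := card_lt_card ⟨hLK, fun hKL => hxL (hKL hx)⟩
            omega) hLne hLconn
          (hL.exists_adj hconn hx hLne) (hcase x hx L hL hLne)
          (by
            intro w hw M hM hMne
            by_contra hno
            push Not at hno
            obtain ⟨a, ha, haT⟩ := hcase w (hLK hw) M
              (hL.erase_of_not_adj hM fun z hz => (hno z hz).1) hMne
            exact (hno a ha).2 haT)
          (by
            intro a ha
            have h1 := hdeg a (hLK ha)
            have h3 := hL.degIn_le ha
            simp only [Set.mem_ofPred_eq]
            split_ifs at * <;> omega)
        refine ⟨[x] ++ l, (isPathList_singleton x).append hl ?_ ?_, ?_, by simp, ?_, ?_, ?_⟩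
        · intro a ha ha'
          simp at ha
          exact hxL (ha ▸ hlL a ha')
        · intro a ha b hb
          simp at ha
          rw [← ha]
          exact hlX b hb
        · intro a ha
          rcases List.mem_append.1 ha with ha | ha
          · simp at ha
            exact ha ▸ hx
          · exact hLK (hlL a ha)
        · simpa using hxX
        · intro a ha
          rw [List.getLast?_append_of_ne_nil _ hl0] at ha
          exact hlT a ha
        · simp
          omega
      · have hKx : K = {x} := by
          rw [not_nonempty_iff_eq_empty, erase_eq_empty_iff] at hK1
          exact hK1.resolve_left hne.ne_empty
        subst hKx
        obtain ⟨t, ht, htT⟩ := hT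
        have := hdeg x hx
        have h0 : degIn G x {x} < 1 := by
          simpa using degIn_lt_card (G := G) (a := x) (B := {x}) (by simp)
        have : r ≤ 2 := by split_ifs at this <;> omega
        simp at ht
        exact ⟨[x], isPathList_singleton x, by simp, by simp, by simpa using hxX,
          by simpa using ht ▸ htT, by simpa using this⟩

theorem connIn_of_induce_connected [Fintype V] {v : V}
    (h : (G.induce ({v}ᶜ : Set V)).Connected) : ConnIn G (univ.erase v) := by
  intro M hM hne
  refine hM.subset.antisymm fun b hb => ?_
  obtain ⟨a, ha⟩ := hne
  have hav : a ≠ v := (mem_erase.1 (hM.subset ha)).1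
  have hbv : b ≠ v := (mem_erase.1 hb).1
  have key : ∀ x y : ({v}ᶜ : Set V), (G.induce ({v}ᶜ : Set V)).Walk x y → (x : V) ∈ M →
      (y : V) ∈ M := by
    intro x y w
    induction w with
    | nil => exact id
    | cons hadj _ ih =>
      rename_i p q s _
      intro hx
      exact ih (hM.mem_of_adj _ hx _ (mem_erase.2 ⟨q.2, mem_univ _⟩) (by simpa using hadj))
  obtain ⟨w⟩ := h.preconnected ⟨a, hav⟩ ⟨b, hbv⟩
  exact key _ _ w ha

end Jackson

namespace Jackson

open Finset

variable {V : Type*} {G : SimpleGraph V} {N : ℕ} {d : ℤ → V}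

/-- A path outside a longest cycle, attached to it at `d i` and `d j`, is not longer than the arc
of the cycle that it replaces. -/
theorem IsPathList.length_lt_gap (hd : IsCycleFun G N d)
    (hmax : ∀ l, IsCycleList G l → l.length ≤ N) {l : List V} (hl : IsPathList G l)
    (hne : l ≠ []) (hout : ∀ c ∈ l, ∀ j, d j ≠ c) {i j : ℤ} (hij : i < j) (hjN : j < i + N)
    (hh : ∀ a ∈ l.head?, G.Adj a (d i)) (ht : ∀ a ∈ l.getLast?, G.Adj a (d j)) :
    (l.length : ℤ) + 1 ≤ j - i := by
  obtain ⟨r, rfl⟩ : ∃ r : ℕ, j = i + N - r := ⟨(i + N - j).toNat, by omega⟩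
  have hlen : 0 < l.length := List.length_pos_of_ne_nil hne
  have hcyc : IsCycleList G (l ++ arc d (i + N - r) (r + 1)) := by
    refine ⟨hl.append (isPathList_arc hd (by omega)) ?_ ?_, by simp; omega, ?_⟩
    · intro c hc hc'
      obtain ⟨t, -, -, rfl⟩ := mem_arc.1 hc'
      exact hout _ hc t rfl
    · intro a ha b hb
      rw [← (head?_arc.1 hb).2]
      exact ht a ha
    · intro a ha b hb
      rw [List.head?_append_of_ne_nil _ hne] at hb
      rw [List.getLast?_append_of_ne_nil _ (by rw [← List.length_pos_iff_ne_nil]; simp)] at ha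
      rw [← (getLast?_arc.1 ha).2]
      convert (hh b hb).symm using 1
      rw [← hd.per i]
      congr 1
      push_cast; ring
  have := hmax _ hcyc
  simp at this
  omega

/-- Between an element of `A \ B` and the next element of `B` there is a long gap after some
element of `A \ B`. -/
theorem exists_gap_of_sdiff [DecidableEq V] (hd : IsCycleFun G N d) {A B : Finset V} {m : ℕ}
    (hA : ∀ a ∈ A, ∃ j, d j = a) (hB : ∀ b ∈ B, ∃ j, d j = b)
    (hgap : ∀ i j : ℤ, i < j → j < i + N → d i ∈ A → d j ∈ B → (m : ℤ) + 1 ≤ j - i)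
    (hAB : (A \ B).Nonempty) (hBne : B.Nonempty) :
    ∃ j, d j ∈ A \ B ∧ ∀ i, j < i → i ≤ j + m → d i ∉ A ∪ B := by
  classical
  have hex₀ : ∃ r : ℕ, r < N ∧ 0 < r ∧ ∃ j, d j ∈ A \ B ∧ d (j + r) ∈ B := by
    obtain ⟨a, ha⟩ := hAB
    obtain ⟨b, hb⟩ := hBne
    obtain ⟨i, rfl⟩ := hA a (mem_sdiff.1 ha).1
    obtain ⟨j, rfl⟩ := hB b hb
    obtain ⟨j', h1, h2, h3, -⟩ := hd.exists_rep i j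
    have hne : i ≠ j' := by
      rintro rfl
      exact (mem_sdiff.1 ha).2 (h3 ▸ hb)
    refine ⟨(j' - i).toNat, by omega, by omega, i, ha, ?_⟩
    rwa [show i + ((j' - i).toNat : ℤ) = j' by omega, h3]
  have hex : ∃ r : ℕ, 0 < r ∧ ∃ j, d j ∈ A \ B ∧ d (j + r) ∈ B := hex₀.imp fun _ h => h.2
  have hlt : Nat.find hex < N := by
    obtain ⟨r, h1, h2⟩ := hex₀
    exact (Nat.find_min' hex h2).trans_lt h1
  obtain ⟨hr, j, hj, hjr⟩ := Nat.find_spec hex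
  have hmin : ∀ s < Nat.find hex, ¬ (0 < s ∧ ∃ j, d j ∈ A \ B ∧ d (j + s) ∈ B) :=
    fun s hs => Nat.find_min hex hs
  generalize Nat.find hex = r at *
  have hmr := hgap j (j + r) (by omega) (by omega) (mem_sdiff.1 hj).1 hjr
  refine ⟨j, hj, fun i h1 h2 hi => ?_⟩
  have hiB : d i ∉ B := fun hiB => by
    refine hmin (i - j).toNat (by omega) ⟨by omega, j, hj, ?_⟩
    rwa [show j + ((i - j).toNat : ℤ) = i by omega]
  have hiA : d i ∈ A := (mem_union.1 hi).resolve_right hiB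
  refine hmin (j + r - i).toNat (by omega) ⟨by omega, i, mem_sdiff.2 ⟨hiA, hiB⟩, ?_⟩
  rwa [show i + ((j + r - i).toNat : ℤ) = j + r by omega]

/-- Lower bound for the length of a cycle carrying two sets `A`, `B` of attachment points. -/
theorem attachment_count [DecidableEq V] [Fintype V] (hd : IsCycleFun G N d) {A B : Finset V}
    {m : ℕ} (hm : 1 ≤ m) (hA : ∀ a ∈ A, ∃ j, d j = a) (hB : ∀ b ∈ B, ∃ j, d j = b)
    (hAB : ∀ i j : ℤ, i < j → j < i + N → d i ∈ A → d j ∈ B → (m : ℤ) + 1 ≤ j - i)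
    (hBA : ∀ i j : ℤ, i < j → j < i + N → d i ∈ B → d j ∈ A → (m : ℤ) + 1 ≤ j - i)
    (hS : ∀ i, d i ∈ A ∪ B → d (i + 1) ∉ A ∪ B)
    (hAne : A.Nonempty) (hBne : B.Nonempty) (h2 : 2 ≤ #(A ∪ B)) :
    2 * #(A ∪ B) + (m - 1) * (#(A ∩ B) + (if (A \ B).Nonempty then 1 else 0) +
      (if (B \ A).Nonempty then 1 else 0)) ≤ N := by
  classical
  have h3 := hd.three_le
  have hmN : m + 1 < N := by
    obtain ⟨a, ha, b, hb, hab⟩ : ∃ a ∈ A, ∃ b ∈ B, a ≠ b := by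
      by_contra! hno
      obtain ⟨b, hb⟩ := hBne
      obtain ⟨a, ha⟩ := hAne
      have e := hno a ha b hb
      have : A ∪ B ⊆ {b} := by
        intro c hc
        rcases mem_union.1 hc with hc | hc
        · exact mem_singleton.2 (hno c hc b hb)
        · exact mem_singleton.2 ((hno a ha c hc).symm.trans e)
      have := card_le_card this
      simp at this
      omega
    obtain ⟨i, rfl⟩ := hA a ha
    obtain ⟨j, rfl⟩ := hB b hb
    obtain ⟨j', h1, h2, h3, -⟩ := hd.exists_rep i j
    have hne : i ≠ j' := by
      rintro rfl
      exact hab h3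
    have := hAB i j' (by omega) h2 ha (h3 ▸ hb)
    omega
  set S := A ∪ B
  set D := {s ∈ S | ∃ j, d j = s ∧ ∀ i, j < i → i ≤ j + m → d i ∉ S} with hD
  have hDcard : #(A ∩ B) + (if (A \ B).Nonempty then 1 else 0) +
      (if (B \ A).Nonempty then 1 else 0) ≤ #D := by
    have e1 : A ∩ B ⊆ D := by
      intro c hc
      obtain ⟨hcA, hcB⟩ := mem_inter.1 hc
      obtain ⟨j, rfl⟩ := hA c hcA
      refine mem_filter.2 ⟨mem_union_left _ hcA, j, rfl, fun i h1 h2 hi => ?_⟩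
      rcases mem_union.1 hi with hi | hi
      · have := hBA j i h1 (by omega) hcB hi
        omega
      · have := hAB j i h1 (by omega) hcA hi
        omega
    have e2 : (if (A \ B).Nonempty then 1 else 0) ≤ #(D ∩ (A \ B)) := by
      split_ifs with h
      · obtain ⟨j, hj, hj'⟩ := exists_gap_of_sdiff hd hA hB hAB h hBne
        exact card_pos.2 ⟨d j, mem_inter.2 ⟨mem_filter.2
          ⟨mem_union_left _ (mem_sdiff.1 hj).1, j, rfl, hj'⟩, hj⟩⟩
      · omega
    have e3 : (if (B \ A).Nonempty then 1 else 0) ≤ #(D ∩ (B \ A)) := by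
      split_ifs with h
      · obtain ⟨j, hj, hj'⟩ := exists_gap_of_sdiff hd hB hA hBA h hAne
        rw [union_comm] at hj'
        exact card_pos.2 ⟨d j, mem_inter.2 ⟨mem_filter.2
          ⟨mem_union_right _ (mem_sdiff.1 hj).1, j, rfl, hj'⟩, hj⟩⟩
      · omega
    have e4 : Disjoint (A ∩ B) (D ∩ (A \ B)) := by
      rw [disjoint_left]
      intro c hc hc'
      exact (mem_sdiff.1 (mem_inter.1 hc').2).2 (mem_inter.1 hc).2
    have e5 : Disjoint ((A ∩ B) ∪ (D ∩ (A \ B))) (D ∩ (B \ A)) := by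
      rw [disjoint_left]
      intro c hc hc'
      have h1 := (mem_sdiff.1 (mem_inter.1 hc').2).2
      rcases mem_union.1 hc with hc | hc
      · exact h1 (mem_inter.1 hc).1
      · exact h1 (mem_sdiff.1 (mem_inter.1 hc).2).1
    have e6 := card_le_card (union_subset (union_subset e1 (inter_subset_left (s₁ := D)
      (s₂ := A \ B))) (inter_subset_left (s₁ := D) (s₂ := B \ A)))
    rw [card_union_of_disjoint e5, card_union_of_disjoint e4] at e6
    omega
  have hpos : ∀ s, ∃ j, s ∈ S → d j = s := by
    intro s
    by_cases hs : s ∈ S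
    · rcases mem_union.1 hs with h | h
      · exact (hA s h).imp fun j hj _ => hj
      · exact (hB s h).imp fun j hj _ => hj
    · exact ⟨0, fun h => absurd h hs⟩
  choose pos hpos using hpos
  set len : V → ℕ := fun s => if s ∈ D then m + 1 else 2 with hlen
  have hkey : ∀ s ∈ S, ∀ s' ∈ S, ∀ i i', pos s ≤ i → i < pos s + len s → pos s' ≤ i' →
      i' < pos s' + len s' → d i = d i' → i - pos s ≤ i' - pos s' → s = s' := by
    intro s hs s' hs' i i' h1 h2 h3 h4 hii hle
    have e1 := hd.congr_add hii (pos s - i)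
    rw [add_sub_cancel, hpos s hs] at e1
    have e2 := hpos s' hs'
    by_cases h5 : i' + (pos s - i) = pos s'
    · rw [h5] at e1
      exact e1.trans e2
    by_cases h6 : i' + (pos s - i) = pos s' + 1
    · rw [h6] at e1
      exact absurd (e1 ▸ hs) (hS (pos s') (e2.symm ▸ hs'))
    have h7 : s' ∈ D := by
      by_contra hsD
      simp only [hlen, if_neg hsD] at h4
      omega
    simp only [hlen, if_pos h7] at h4
    obtain ⟨-, j, hj, hj'⟩ := mem_filter.1 h7
    refine absurd (e1 ▸ hs) ?_
    have e3 := hd.congr_add (hj.trans e2.symm) (i' + (pos s - i) - pos s')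
    rw [add_sub_cancel] at e3
    rw [← e3]
    exact hj' _ (by omega) (by omega)
  have hsum : ∑ s ∈ S, len s ≤ N := by
    have e1 : ∀ s ∈ S, #(arc d (pos s) (len s)).toFinset = len s := by
      intro s hs
      rw [List.toFinset_card_of_nodup (isPathList_arc hd ?_).nodup, length_arc]
      simp only [hlen]
      split_ifs <;> omega
    rw [← sum_congr rfl e1, ← card_biUnion]
    · have : #(arc d 0 N).toFinset = N := by
        rw [List.toFinset_card_of_nodup (isPathList_arc hd le_rfl).nodup, length_arc]
      rw [← this]
      refine card_le_card (biUnion_subset.2 fun u hu c hc => ?_)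
      obtain ⟨j, h1, h2, rfl⟩ := mem_arc.1 (List.mem_toFinset.1 hc)
      exact List.mem_toFinset.2 ((mem_arc_full hd 0).2 ⟨j, rfl⟩)
    · intro s hs s' hs' hne
      rw [Function.onFun, disjoint_left]
      intro c hc hc'
      obtain ⟨i, h1, h2, rfl⟩ := mem_arc.1 (List.mem_toFinset.1 hc)
      obtain ⟨j, h3, h4, hj⟩ := mem_arc.1 (List.mem_toFinset.1 hc')
      rcases le_total (i - pos s) (j - pos s') with hle | hle
      · exact hne (hkey s hs s' hs' i j h1 h2 h3 h4 hj.symm hle)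
      · exact hne (hkey s' hs' s hs j i h3 h4 h1 h2 hj hle).symm
  have hlen' : ∀ s ∈ S, len s = 2 + (m - 1) * (if s ∈ D then 1 else 0) := by
    intro s _
    simp only [hlen]
    split_ifs <;> omega
  rw [sum_congr rfl hlen', sum_add_distrib, ← mul_sum, sum_const, sum_boole, smul_eq_mul,
    Nat.cast_id, filter_mem_eq_inter, inter_eq_right.2 (filter_subset _ _)] at hsum
  have := Nat.mul_le_mul_left (m - 1) hDcard
  linarith

/-- The arithmetic behind the uniqueness of attachment sets. -/
theorem attachment_arith {i α β m k N : ℕ} (hm : 2 ≤ m) (hα : k + 1 ≤ i + α + m)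
    (hβ : k + 1 ≤ i + β + m) (hA : 1 ≤ i + α) (hB : 1 ≤ i + β) (h2 : 2 ≤ i + α + β)
    (hN : 2 * (i + α + β) + (m - 1) * (i + (if 0 < α then 1 else 0) + (if 0 < β then 1 else 0)) ≤ N)
    (hk : N + m ≤ 3 * k) : α = 0 ∧ β = 0 ∧ i + m = k + 1 := by
  obtain ⟨m, rfl⟩ : ∃ t, m = t + 2 := ⟨m - 2, by omega⟩
  rw [show m + 2 - 1 = m + 1 by omega] at hN
  rcases Nat.eq_zero_or_pos α with rfl | ha <;> rcases Nat.eq_zero_or_pos β with rfl | hb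
  · refine ⟨rfl, rfl, ?_⟩
    by_contra hne
    have h3 : m * 2 ≤ m * i := Nat.mul_le_mul_left _ (by omega)
    have h4 : k + 2 ≤ i + (m + 2) := by omega
    simp at hN
    nlinarith
  · simp [hb] at hN
    have h3 : m * 1 ≤ m * i := Nat.mul_le_mul_left _ (by omega)
    nlinarith
  · simp [ha] at hN
    have h3 : m * 1 ≤ m * i := Nat.mul_le_mul_left _ (by omega)
    nlinarith
  · simp [ha, hb] at hN
    have h3 : 0 ≤ m * i := Nat.zero_le _
    nlinarith

end Jackson

namespace Jackson

open Finset

variable {V : Type*} {G : SimpleGraph V} {N : ℕ} {d : ℤ → V} [DecidableEq V]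

/-- The vertex set of the cycle `d` of length `N`. -/
def cycleSet (N : ℕ) (d : ℤ → V) : Finset V := (arc d 0 N).toFinset

theorem mem_cycleSet (hd : IsCycleFun G N d) {c : V} : c ∈ cycleSet N d ↔ ∃ j, d j = c := by
  rw [cycleSet, List.mem_toFinset, mem_arc_full hd]

theorem card_cycleSet (hd : IsCycleFun G N d) : #(cycleSet N d) = N := by
  rw [cycleSet, List.toFinset_card_of_nodup (isPathList_arc hd le_rfl).nodup, length_arc]

theorem IsCycleFun.apply_mem (hd : IsCycleFun G N d) (j : ℤ) : d j ∈ cycleSet N d :=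
  (mem_cycleSet hd).2 ⟨j, rfl⟩

/-- Every vertex other than `v` belongs to a nonempty union of components of `G - v`, provided
`G - v` is connected; so such a union meets every cycle. -/
theorem ClosedIn.exists_mem_cycleSet [Fintype V] (hd : IsCycleFun G N d) {v : V} {M : Finset V}
    (h2 : ConnIn G (univ.erase v)) (hM : ClosedIn G (univ.erase v) M) (hne : M.Nonempty) :
    ∃ c ∈ cycleSet N d, c ∈ M := by
  have h3 := hd.three_le
  have hMe := h2 M hM hne
  by_cases h0 : d 0 = v
  · refine ⟨d 1, hd.apply_mem 1, ?_⟩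
    rw [hMe, mem_erase]
    refine ⟨fun h1 => ?_, mem_univ _⟩
    have := hd.inj 1 0 (h1.trans h0.symm) (by omega) (by omega)
    omega
  · refine ⟨d 0, hd.apply_mem 0, ?_⟩
    rw [hMe, mem_erase]
    exact ⟨h0, mem_univ _⟩

/-- The bound of `attachment_count` for the ends of a path outside a longest cycle. -/
theorem IsPathList.attachment_count [Fintype V] (hd : IsCycleFun G N d)
    (hmax : ∀ l, IsCycleList G l → l.length ≤ N) {l : List V} (hl : IsPathList G l)
    (hout : ∀ c ∈ l, ∀ j, d j ≠ c) {p q : V} (hp : p ∈ l.head?) (hq : q ∈ l.getLast?)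
    {A B : Finset V} (hA : ∀ a ∈ A, (∃ j, d j = a) ∧ G.Adj p a)
    (hB : ∀ b ∈ B, (∃ j, d j = b) ∧ G.Adj q b) (hAne : A.Nonempty) (hBne : B.Nonempty)
    (h2 : 2 ≤ #(A ∪ B)) :
    2 * #(A ∪ B) + (l.length - 1) * (#(A ∩ B) + (if (A \ B).Nonempty then 1 else 0) +
      (if (B \ A).Nonempty then 1 else 0)) ≤ N := by
  have h3 := hd.three_le
  have hne : l ≠ [] := by
    rintro rfl
    simp at hp
  have hlen := List.length_pos_of_ne_nil hne
  have hAB : ∀ i j : ℤ, i < j → j < i + N → d i ∈ A → d j ∈ B → (l.length : ℤ) + 1 ≤ j - i := by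
    intro i j hij hjN hi hj
    refine hl.length_lt_gap hd hmax hne hout hij hjN ?_ ?_
    · intro a ha
      rw [Option.mem_unique ha hp]
      exact (hA _ hi).2
    · intro a ha
      rw [Option.mem_unique ha hq]
      exact (hB _ hj).2
  have hBA : ∀ i j : ℤ, i < j → j < i + N → d i ∈ B → d j ∈ A → (l.length : ℤ) + 1 ≤ j - i := by
    intro i j hij hjN hi hj
    rw [← List.length_reverse (as := l)]
    refine hl.reverse.length_lt_gap hd hmax (by simpa using hne) (by simpa using hout) hij hjN ?_ ?_
    · intro a ha
      rw [List.head?_reverse] at ha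
      rw [Option.mem_unique ha hq]
      exact (hB _ hi).2
    · intro a ha
      rw [List.getLast?_reverse] at ha
      rw [Option.mem_unique ha hp]
      exact (hA _ hj).2
  have single : ∀ c ∈ l, ∀ i, G.Adj c (d i) → ¬ G.Adj c (d (i + 1)) := by
    intro c hc i h1 h2
    have := (isPathList_singleton (G := G) c).length_lt_gap hd hmax (by simp)
      (by simpa using hout c hc) (i := i) (j := i + 1) (by omega) (by omega) (by simpa using h1)
      (by simpa using h2)
    simp at this
  refine Jackson.attachment_count hd hlen (fun a ha => (hA a ha).1) (fun b hb => (hB b hb).1) hAB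
    hBA ?_ hAne hBne h2
  intro i hi hi'
  rcases mem_union.1 hi with hi | hi <;> rcases mem_union.1 hi' with hi' | hi'
  · exact single p (List.mem_of_mem_head? hp) i (hA _ hi).2 (hA _ hi').2
  · have := hAB i (i + 1) (by omega) (by omega) hi hi'
    omega
  · have := hBA i (i + 1) (by omega) (by omega) hi hi'
    omega
  · exact single q (List.mem_of_mem_getLast? hq) i (hB _ hi).2 (hB _ hi').2

/-- If a longest cycle misses an edge completely, its length is at least `2k` (Dirac). -/
theorem two_mul_le_length [Fintype V] (hd : IsCycleFun G N d)
    (hmax : ∀ l, IsCycleList G l → l.length ≤ N) {k : ℕ} (hreg : ∀ a, degIn G a univ = k)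
    (h2 : ∀ v, ConnIn G (univ.erase v)) {a b : V} (ha : ∀ j, d j ≠ a) (hb : ∀ j, d j ≠ b)
    (hab : G.Adj a b) : 2 * k ≤ N := by
  classical
  set C := cycleSet N d with hC
  have hmemC : ∀ c, c ∈ C ↔ ∃ j, d j = c := fun c => mem_cycleSet hd
  have hCN : #C = N := card_cycleSet hd
  have h3 := hd.three_le
  have hO : ∀ c, c ∈ univ \ C ↔ ∀ j, d j ≠ c := by
    intro c
    simp [hmemC]
  obtain ⟨H, hH, haH, hHconn⟩ := exists_connIn_closedIn_mem (G := G) ((hO a).2 ha)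
  have hbH : b ∈ H := hH.mem_of_adj a haH b ((hO b).2 hb) hab
  have hHout : ∀ c ∈ H, ∀ j, d j ≠ c := fun c hc => (hO c).1 (hH.subset hc)
  have hHC : Disjoint H C := disjoint_left.2 fun c hc => (mem_sdiff.1 (hH.subset hc)).2
  have hHdeg : ∀ h ∈ H, degIn G h H + degIn G h C = k := by
    intro h hh
    rw [← degIn_union_of_disjoint h hHC, ← hreg h]
    refine degIn_eq_of_forall (subset_univ _) fun c _ hc => ?_
    by_cases hcC : c ∈ C
    · exact mem_union_right _ hcC
    · exact mem_union_left _ (hH.mem_of_adj h hh c (mem_sdiff.2 ⟨mem_univ _, hcC⟩) hc)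
  -- a union of components of `H - w` has a neighbour on the cycle
  have hTmeet : ∀ w, ∀ M, ClosedIn G (H.erase w) M → M.Nonempty → ∃ z ∈ M, ∃ c ∈ C, c ≠ w ∧
      G.Adj z c := by
    intro w M hM hne
    by_contra hno
    push Not at hno
    have hMH : M ⊆ H := hM.subset.trans (erase_subset _ _)
    have hcl : ClosedIn G (univ.erase w) M := by
      refine ⟨fun z hz => mem_erase.2 ⟨(mem_erase.1 (hM.subset hz)).1, mem_univ _⟩,
        fun z hz c hc hzc => ?_⟩
      have hcw := (mem_erase.1 hc).1
      by_cases hcC : c ∈ C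
      · exact absurd hzc (hno z hz c hcC hcw)
      · exact hM.mem_of_adj z hz c (mem_erase.2 ⟨hcw, hH.mem_of_adj z (hMH hz) c
          (mem_sdiff.2 ⟨mem_univ _, hcC⟩) hzc⟩) hzc
    obtain ⟨c, hcC, hcM⟩ := hcl.exists_mem_cycleSet hd (h2 w) hne
    exact disjoint_left.1 hHC (hMH hcM) hcC
  have hHer : ∀ c ∈ C, H.erase c = H := fun c hc =>
    erase_eq_of_notMem fun hcH => disjoint_left.1 hHC hcH hc
  obtain ⟨h, hh, hhmax⟩ := H.exists_max_image (fun h => degIn G h C) ⟨a, haH⟩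
  by_cases hΔ : 2 ≤ degIn G h C
  · have hne : (H.erase h).Nonempty := by
      by_cases hah : a = h
      · exact ⟨b, mem_erase.2 ⟨fun hbh => hab.ne (hah.trans hbh.symm), hbH⟩⟩
      · exact ⟨a, mem_erase.2 ⟨hah, haH⟩⟩
    obtain ⟨L, hL, hLne, hLconn⟩ := exists_connIn_closedIn (G := G) hne
    have hLH : L ⊆ H := hL.subset.trans (erase_subset _ _)
    have hhL : h ∉ L := fun hhL => by simpa using hL.subset hhL
    obtain ⟨l, hl, hlL, hl0, hlh, hlT, hlr⟩ := exists_long_path (G := G) #L L {z | G.Adj h z}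
      {z | ∃ c ∈ C, G.Adj z c} (k - degIn G h C + 1) le_rfl hLne hLconn
      (hL.exists_adj hHconn hh hLne)
      (by
        obtain ⟨z, hz, c, hc, -, hzc⟩ := hTmeet h L hL hLne
        exact ⟨z, hz, c, hc, hzc⟩)
      (by
        intro w hw M hM hMne
        by_contra hno
        push Not at hno
        obtain ⟨z, hz, c, hc, -, hzc⟩ := hTmeet w M
          (hL.erase_of_not_adj hM fun z hz => (hno z hz).1) hMne
        exact (hno z hz).2 ⟨c, hc, hzc⟩)
      (by
        intro z hz
        have e1 := hL.degIn_le hz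
        have e2 := hHdeg z (hLH hz)
        have e3 := hhmax z (hLH hz)
        have e4 := hHdeg h hh
        simp only [Set.mem_ofPred_eq]
        by_cases hzT : ∃ c ∈ C, G.Adj z c
        · rw [if_pos hzT]
          omega
        · rw [if_neg hzT]
          have : degIn G z C = 0 := degIn_eq_zero fun c hc hzc => hzT ⟨c, hc, hzc⟩
          omega)
    obtain ⟨q, hq⟩ : ∃ q, q ∈ l.getLast? := ⟨_, List.getLast?_eq_some_getLast hl0⟩
    obtain ⟨c, hcC, hqc⟩ := hlT q hq
    have hpath : IsPathList G ([h] ++ l) := by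
      refine (isPathList_singleton h).append hl ?_ ?_
      · intro x hx hx'
        simp at hx
        exact hhL (hx ▸ hlL x hx')
      · intro x hx y hy
        simp at hx
        exact hx ▸ hlh y hy
    have hpout : ∀ x ∈ [h] ++ l, ∀ j, d j ≠ x := by
      intro x hx
      rcases List.mem_append.1 hx with hx | hx
      · simp at hx
        exact hx ▸ hHout h hh
      · exact hHout x (hLH (hlL x hx))
    set A := {c ∈ C | G.Adj h c} with hA
    have hAc : #A = degIn G h C := by rw [degIn]
    have hcount := hpath.attachment_count hd hmax hpout (p := h) (q := q) (by simp)
      (by rw [List.getLast?_append_of_ne_nil _ hl0]; exact hq) (A := A) (B := {c})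
      (fun x hx => ⟨(hmemC x).1 (mem_filter.1 hx).1, (mem_filter.1 hx).2⟩)
      (fun x hx => by
        rw [mem_singleton] at hx
        exact hx ▸ ⟨(hmemC c).1 hcC, hqc⟩)
      (card_pos.1 (by omega)) (by simp)
      (by
        have := card_le_card (subset_union_left (s₁ := A) (s₂ := {c}))
        omega)
    have hAB : (A \ {c}).Nonempty := by
      rw [← card_pos]
      have := le_card_sdiff {c} A
      simp at this
      omega
    rw [if_pos hAB] at hcount
    simp only [List.length_append, List.length_singleton, Nat.add_sub_cancel_left] at hcount
    by_cases hcA : c ∈ A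
    · rw [inter_singleton_of_mem hcA, union_eq_left.2 (by simpa using hcA),
        card_singleton] at hcount
      have : l.length * (1 + 1) ≤ l.length * (1 + 1 + if (({c} : Finset V) \ A).Nonempty then 1
        else 0) := Nat.mul_le_mul_left _ (by omega)
      omega
    · rw [if_pos ⟨c, mem_sdiff.2 ⟨mem_singleton_self c, hcA⟩⟩, inter_singleton_of_notMem hcA,
        card_empty] at hcount
      have := card_le_card (subset_union_left (s₁ := A) (s₂ := {c}))
      omega
  · obtain ⟨z₁, hz₁, c₁, hc₁, -, hzc₁⟩ := hTmeet (d 0) H (by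
      rw [hHer _ (hd.apply_mem 0)]; exact ClosedIn.refl H) ⟨a, haH⟩
    obtain ⟨l, hl, hlH, hl0, hl1, hl2, hlr⟩ := exists_long_path (G := G) #H H {z | G.Adj z c₁}
      {z | ∃ c ∈ C, c ≠ c₁ ∧ G.Adj z c} k le_rfl ⟨a, haH⟩ hHconn ⟨z₁, hz₁, hzc₁⟩
      (hTmeet c₁ H (by rw [hHer _ hc₁]; exact ClosedIn.refl H) ⟨a, haH⟩)
      (by
        intro w hw M hM hMne
        obtain ⟨z, hz, c, hc, -, hzc⟩ := hTmeet w M hM hMne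
        refine ⟨z, hz, ?_⟩
        by_cases hcc : c = c₁
        · exact Or.inl (hcc ▸ hzc)
        · exact Or.inr ⟨c, hc, hcc, hzc⟩)
      (by
        intro z hz
        have e2 := hHdeg z hz
        have e3 := hhmax z hz
        by_cases h0 : ∃ c ∈ C, G.Adj z c
        · obtain ⟨c, hc, hzc⟩ := h0
          by_cases hcc : c = c₁
          · rw [if_pos (show z ∈ {z | G.Adj z c₁} from hcc ▸ hzc)]
            omega
          · rw [if_pos (show z ∈ {z | ∃ c ∈ C, c ≠ c₁ ∧ G.Adj z c} from ⟨c, hc, hcc, hzc⟩)]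
            omega
        · have : degIn G z C = 0 := degIn_eq_zero fun c hc hzc => h0 ⟨c, hc, hzc⟩
          omega)
    obtain ⟨p, hp⟩ : ∃ p, p ∈ l.head? := ⟨_, List.head?_eq_some_head hl0⟩
    obtain ⟨q, hq⟩ : ∃ q, q ∈ l.getLast? := ⟨_, List.getLast?_eq_some_getLast hl0⟩
    obtain ⟨c₂, hc₂, hne, hqc₂⟩ := hl2 q hq
    have hcount := hl.attachment_count hd hmax (fun c hc => hHout c (hlH c hc)) hp hq (A := {c₁})
      (B := {c₂})
      (fun x hx => by
        rw [mem_singleton] at hx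
        exact hx ▸ ⟨(hmemC c₁).1 hc₁, hl1 p hp⟩)
      (fun x hx => by
        rw [mem_singleton] at hx
        exact hx ▸ ⟨(hmemC c₂).1 hc₂, hqc₂⟩) (by simp) (by simp)
      (by simp [card_pair hne.symm])
    have hpos := List.length_pos_of_ne_nil hl0
    rw [if_pos ⟨c₁, by simp [hne.symm]⟩, if_pos ⟨c₂, by simp [hne]⟩,
      ← insert_eq, card_pair hne.symm] at hcount
    have := Nat.mul_le_mul_left (l.length - 1)
      (show 2 ≤ #({c₁} ∩ {c₂} : Finset V) + 1 + 1 by omega)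
    omega

end Jackson

namespace Jackson

open Finset

variable {V : Type*} {G : SimpleGraph V} {N : ℕ} {d : ℤ → V}

/-- A path outside a longest cycle attached at `d i` and `d j`, combined with a crossing chord from
`d (i + 1)` to `d (j + t)`. -/
theorem IsPathList.length_lt_of_crossing (hd : IsCycleFun G N d)
    (hmax : ∀ l, IsCycleList G l → l.length ≤ N) {l : List V} (hl : IsPathList G l)
    (hne : l ≠ []) (hout : ∀ c ∈ l, ∀ j, d j ≠ c) {i j t : ℤ} (hij : i < j) (ht : 0 < t)
    (hjN : j + t ≤ i + N) (hh : ∀ a ∈ l.head?, G.Adj a (d i))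
    (hlast : ∀ a ∈ l.getLast?, G.Adj a (d j)) (hadj : G.Adj (d (i + 1)) (d (j + t))) :
    (l.length : ℤ) + 1 ≤ t := by
  obtain ⟨r, rfl⟩ : ∃ r : ℕ, j = i + r := ⟨(j - i).toNat, by omega⟩
  obtain ⟨s, hs⟩ : ∃ s : ℕ, i + N = i + r + t + s := ⟨(i + N - (i + r + t)).toNat, by omega⟩
  have hr : (arc d (i + 1) r).reverse ≠ [] := by
    rw [← List.length_pos_iff_ne_nil]
    simp
    omega
  have hs0 : arc d (i + r + t) (s + 1) ≠ [] := by
    rw [← List.length_pos_iff_ne_nil]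
    simp
  have hlen : 0 < l.length := List.length_pos_of_ne_nil hne
  have hcyc : IsCycleList G (l ++ ((arc d (i + 1) r).reverse ++ arc d (i + r + t) (s + 1))) := by
    refine ⟨hl.append ((isPathList_arc hd (by omega)).reverse.append
      (isPathList_arc hd (by omega)) ?_ ?_) ?_ ?_, ?_, ?_⟩
    · intro c hc hc'
      obtain ⟨x, h1, h2, rfl⟩ := mem_arc.1 (List.mem_reverse.1 hc)
      obtain ⟨y, h3, h4, h5⟩ := mem_arc.1 hc'
      have := hd.inj y x h5 (by omega) (by omega)
      omega
    · intro a ha b hb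
      rw [List.getLast?_reverse] at ha
      rw [← (head?_arc.1 ha).2, ← (head?_arc.1 hb).2]
      exact hadj
    · intro c hc hc'
      rcases List.mem_append.1 hc' with hc' | hc'
      · obtain ⟨x, -, -, rfl⟩ := mem_arc.1 (List.mem_reverse.1 hc')
        exact hout _ hc x rfl
      · obtain ⟨x, -, -, rfl⟩ := mem_arc.1 hc'
        exact hout _ hc x rfl
    · intro a ha b hb
      rw [List.head?_append_of_ne_nil _ hr, List.head?_reverse] at hb
      rw [← (getLast?_arc.1 hb).2]
      convert hlast a ha using 2
      ring
    · simp
      omega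
    · intro a ha b hb
      rw [List.head?_append_of_ne_nil _ hne] at hb
      rw [List.getLast?_append_of_ne_nil _ (by simp [hs0]),
        List.getLast?_append_of_ne_nil _ hs0] at ha
      rw [← (getLast?_arc.1 ha).2]
      convert (hh b hb).symm using 1
      rw [← hd.per i]
      congr 1
      push_cast
      linarith
  have := hmax _ hcyc
  simp at this
  omega

/-- A path avoiding the cycle `d` and longest with this property. -/
structure IsLongestAvoiding (G : SimpleGraph V) (d : ℤ → V) (l : List V) : Prop
    extends IsPathList G l where
  out : ∀ c ∈ l, ∀ j, d j ≠ c
  le : ∀ l', IsPathList G l' → (∀ c ∈ l', ∀ j, d j ≠ c) → l'.length ≤ l.length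

namespace IsLongestAvoiding

variable {l : List V}

theorem reverse (h : IsLongestAvoiding G d l) : IsLongestAvoiding G d l.reverse :=
  ⟨h.toIsPathList.reverse, by simpa using h.out, by simpa using h.le⟩

theorem mem_of_adj_head (h : IsLongestAvoiding G d l) {p c : V} (hp : p ∈ l.head?)
    (hc : ∀ j, d j ≠ c) (hpc : G.Adj p c) : c ∈ l := by
  by_contra hcl
  have h1 : IsPathList G ([c] ++ l) := by
    refine (isPathList_singleton c).append h.toIsPathList (by simpa using hcl) ?_
    intro a ha b hb
    simp at ha
    rw [Option.mem_unique hb hp, ← ha]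
    exact hpc.symm
  have h2 := h.le _ h1 (by
    intro x hx
    rcases List.mem_append.1 hx with hx | hx
    · simp at hx
      exact hx ▸ hc
    · exact h.out x hx)
  simp at h2

variable [Fintype V] [DecidableEq V] {k : ℕ}

theorem degIn_add_degIn (h : IsLongestAvoiding G d l) (hd : IsCycleFun G N d)
    (hreg : ∀ a, degIn G a univ = k) {p : V} (hp : p ∈ l.head?) :
    degIn G p (cycleSet N d) + degIn G p l.toFinset = k := by
  rw [← degIn_union_of_disjoint, ← hreg p]
  · refine degIn_eq_of_forall (subset_univ _) fun c _ hc => ?_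
    by_cases hcC : c ∈ cycleSet N d
    · exact mem_union_left _ hcC
    · refine mem_union_right _ (List.mem_toFinset.2 (h.mem_of_adj_head hp (fun j hj => ?_) hc))
      exact hcC ((mem_cycleSet hd).2 ⟨j, hj⟩)
  · rw [disjoint_left]
    intro c hc hcl
    obtain ⟨j, hj⟩ := (mem_cycleSet hd).1 hc
    exact h.out c (List.mem_toFinset.1 hcl) j hj

theorem le_degIn (h : IsLongestAvoiding G d l) (hd : IsCycleFun G N d)
    (hreg : ∀ a, degIn G a univ = k) {p : V} (hp : p ∈ l.head?) :
    k + 1 ≤ degIn G p (cycleSet N d) + l.length := by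
  have h1 := h.degIn_add_degIn hd hreg hp
  have h2 := degIn_lt_card (G := G) (List.mem_toFinset.2 (List.mem_of_mem_head? hp))
  rw [List.toFinset_card_of_nodup h.nodup] at h2
  omega

theorem length_add_le (h : IsLongestAvoiding G d l) (hd : IsCycleFun G N d) :
    N + l.length ≤ Fintype.card V := by
  rw [← card_cycleSet hd, ← List.toFinset_card_of_nodup h.nodup, ← card_union_of_disjoint]
  · exact card_le_univ _
  · rw [disjoint_left]
    intro c hc hcl
    obtain ⟨j, hj⟩ := (mem_cycleSet hd).1 hc
    exact h.out c (List.mem_toFinset.1 hcl) j hj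

/-- Both ends of a longest path avoiding a longest cycle have the same neighbours on the cycle, and
they are adjacent to all other vertices of the path. -/
theorem ends (h : IsLongestAvoiding G d l) (hd : IsCycleFun G N d)
    (hmax : ∀ l, IsCycleList G l → l.length ≤ N) (hreg : ∀ a, degIn G a univ = k)
    (hk : Fintype.card V ≤ 3 * k) (hN : 2 * k ≤ N) (h2 : 2 ≤ l.length) {p q : V}
    (hp : p ∈ l.head?) (hq : q ∈ l.getLast?) :
    (∀ c ∈ cycleSet N d, G.Adj p c ↔ G.Adj q c) ∧
      degIn G p (cycleSet N d) + l.length = k + 1 ∧ ∀ c ∈ l, c ≠ p → G.Adj p c := by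
  classical
  have hcard := h.length_add_le hd
  have ep := h.le_degIn hd hreg hp
  have eq := h.reverse.le_degIn hd hreg (p := q) (by rwa [List.head?_reverse])
  rw [List.length_reverse] at eq
  set C := cycleSet N d with hC
  set A := {c ∈ C | G.Adj p c} with hA
  set B := {c ∈ C | G.Adj q c} with hB
  have hAc : #A = degIn G p C := by rw [degIn]
  have hBc : #B = degIn G q C := by rw [degIn]
  have key : A \ B = ∅ ∧ B \ A = ∅ ∧ #A + l.length = k + 1 := by
    have iA := card_sdiff_add_card_inter A B
    have iB := card_sdiff_add_card_inter B A
    rw [inter_comm] at iB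
    have iU : #(A ∪ B) = #(A ∩ B) + #(A \ B) + #(B \ A) := by
      have := card_union_add_card_inter A B
      omega
    by_cases hAB : 2 ≤ #(A ∪ B)
    · have hcount := h.toIsPathList.attachment_count hd hmax h.out hp hq (A := A) (B := B)
        (fun a ha => ⟨(mem_cycleSet hd).1 (mem_filter.1 ha).1, (mem_filter.1 ha).2⟩)
        (fun a ha => ⟨(mem_cycleSet hd).1 (mem_filter.1 ha).1, (mem_filter.1 ha).2⟩)
        (card_pos.1 (by omega)) (card_pos.1 (by omega)) hAB
      simp only [← card_pos] at hcount
      rw [iU] at hcount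
      have := attachment_arith (k := k) h2 (by omega) (by omega) (by omega) (by omega) (by omega)
        hcount (by omega)
      exact ⟨card_eq_zero.1 this.1, card_eq_zero.1 this.2.1, by omega⟩
    · have a1 := card_le_card (subset_union_left (s₁ := A) (s₂ := B))
      exact ⟨card_eq_zero.1 (by omega), card_eq_zero.1 (by omega), by omega⟩
  obtain ⟨k1, k2, k3⟩ := key
  refine ⟨fun c hc => ⟨fun hpc => ?_, fun hqc => ?_⟩, by omega, fun c hc hcp => ?_⟩
  · exact (mem_filter.1 (sdiff_eq_empty_iff_subset.1 k1 (mem_filter.2 ⟨hc, hpc⟩))).2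
  · exact (mem_filter.1 (sdiff_eq_empty_iff_subset.1 k2 (mem_filter.2 ⟨hc, hqc⟩))).2
  · by_contra hno
    have e1 := h.degIn_add_degIn hd hreg hp
    rw [← hC] at e1
    have hpl := List.mem_toFinset.2 (List.mem_of_mem_head? hp)
    have hcl := List.mem_toFinset.2 hc
    have e2 : degIn G p ((l.toFinset.erase p).erase c) = degIn G p l.toFinset := by
      refine degIn_eq_of_forall ((erase_subset _ _).trans (erase_subset _ _)) fun x hx hpx => ?_
      refine mem_erase.2 ⟨fun hxc => hno (hxc ▸ hpx), mem_erase.2 ⟨hpx.ne', hx⟩⟩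
    have e3 := degIn_le_card (G := G) p ((l.toFinset.erase p).erase c)
    rw [e2, card_erase_of_mem (mem_erase.2 ⟨hcp, hcl⟩), card_erase_of_mem hpl,
      List.toFinset_card_of_nodup h.nodup] at e3
    omega

theorem rotate {s t : List V} (h : IsLongestAvoiding G d (s ++ t)) (hd : IsCycleFun G N d)
    (hmax : ∀ l, IsCycleList G l → l.length ≤ N) (hreg : ∀ a, degIn G a univ = k)
    (hk : Fintype.card V ≤ 3 * k) (hN : 2 * k ≤ N) (h2 : 2 ≤ (s ++ t).length) :
    IsLongestAvoiding G d (t ++ s) := by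
  obtain ⟨hs, ht, hst, -⟩ := isPathList_append.1 h.toIsPathList
  refine ⟨ht.append hs (fun a ha ha' => hst a ha' ha) ?_, ?_, ?_⟩
  · intro q hq p hp
    have hsne : s ≠ [] := by
      rintro rfl
      simp at hp
    have htne : t ≠ [] := by
      rintro rfl
      simp at hq
    have hpl : p ∈ (s ++ t).head? := by rwa [List.head?_append_of_ne_nil _ hsne]
    have hql : q ∈ (s ++ t).getLast? := by rwa [List.getLast?_append_of_ne_nil _ htne]
    refine ((h.ends hd hmax hreg hk hN h2 hpl hql).2.2 q (List.mem_of_mem_getLast? hql) ?_).symm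
    rintro rfl
    exact hst q (List.mem_of_mem_head? hp) (List.mem_of_mem_getLast? hq)
  · intro c hc
    exact h.out c (by simpa [or_comm] using hc)
  · intro l' hl' hout
    have := h.le l' hl' hout
    simpa [add_comm] using this

/-- All vertices of a longest path avoiding a longest cycle have the same neighbours on the
cycle. -/
theorem adj_iff (h : IsLongestAvoiding G d l) (hd : IsCycleFun G N d)
    (hmax : ∀ l, IsCycleList G l → l.length ≤ N) (hreg : ∀ a, degIn G a univ = k)
    (hk : Fintype.card V ≤ 3 * k) (hN : 2 * k ≤ N) (h2 : 2 ≤ l.length) {p : V}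
    (hp : p ∈ l.head?) {x : V} (hx : x ∈ l) {c : V} (hc : c ∈ cycleSet N d) :
    G.Adj x c ↔ G.Adj p c := by
  suffices hs : ∀ s t, l = s ++ t → ∀ x ∈ s, G.Adj x c ↔ G.Adj p c from
    hs l [] (by simp) x hx
  intro s
  induction s using List.reverseRecOn with
  | nil => simp
  | append_singleton s y ih =>
    intro t hl x hx
    rw [List.append_assoc] at hl
    rcases List.mem_append.1 hx with hx | hx
    · exact ih _ hl x hx
    · obtain rfl : x = y := by simpa using hx
      rcases eq_or_ne s [] with rfl | hsne
      · rw [hl] at hp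
        obtain rfl : x = p := by simpa using hp
        rfl
      · obtain ⟨z, hz⟩ : ∃ z, z ∈ s.getLast? := ⟨_, List.getLast?_eq_some_getLast hsne⟩
        rw [← ih _ hl z (List.mem_of_mem_getLast? hz)]
        rw [hl] at h h2
        have hrot := h.rotate hd hmax hreg hk hN h2
        exact (hrot.ends hd hmax hreg hk hN (by simpa [add_comm, add_assoc, add_left_comm] using h2)
          (p := x) (q := z) (by simp)
          (by rw [List.getLast?_append_of_ne_nil _ hsne]; exact hz)).1 c hc

end IsLongestAvoiding

end Jackson

namespace Jackson

open Finset

variable {V : Type*} {G : SimpleGraph V} {N : ℕ} {d : ℤ → V}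

theorem exists_longest {p : List V → Prop} [Fintype V] (hp : ∃ l, p l)
    (hle : ∀ l, p l → l.length ≤ Fintype.card V) :
    ∃ l, p l ∧ ∀ l', p l' → l'.length ≤ l.length := by
  classical
  obtain ⟨l₀, h₀⟩ := hp
  have hex : ∃ r, ∃ l, p l ∧ Fintype.card V - l.length = r := ⟨_, l₀, h₀, rfl⟩
  obtain ⟨l, h1, h2⟩ := Nat.find_spec hex
  refine ⟨l, h1, fun l' hl' => ?_⟩
  have e1 := Nat.find_min' hex ⟨l', hl', rfl⟩
  have e2 := hle l' hl'
  have e3 := hle l h1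
  omega

theorem exists_isLongestAvoiding [Fintype V] {l : List V} (hl : IsPathList G l)
    (hout : ∀ c ∈ l, ∀ j, d j ≠ c) : ∃ l', IsLongestAvoiding G d l' ∧ l.length ≤ l'.length := by
  obtain ⟨l', h, hle⟩ := exists_longest
    (p := fun l => IsPathList G l ∧ ∀ c ∈ l, ∀ j, d j ≠ c) ⟨l, hl, hout⟩
    fun l hl => hl.1.length_le_card
  exact ⟨l', ⟨h.1, h.2, fun m hm hmo => hle m ⟨hm, hmo⟩⟩, hle l ⟨hl, hout⟩⟩

theorem degIn_eq_card {a : V} {B : Finset V} (h : ∀ b ∈ B, G.Adj a b) : degIn G a B = #B := by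
  classical
  unfold degIn
  rw [filter_true_of_mem h]

/-- In a 2-connected `k`-regular graph on at most `3k` vertices, a longest cycle meets every
edge. -/
theorem false_of_adj_outside [Fintype V] [DecidableEq V] (hd : IsCycleFun G N d)
    (hmax : ∀ l, IsCycleList G l → l.length ≤ N) {k : ℕ} (hreg : ∀ a, degIn G a univ = k)
    (hk : Fintype.card V ≤ 3 * k) (h2 : ∀ v, ConnIn G (univ.erase v)) {a b : V}
    (ha : ∀ j, d j ≠ a) (hb : ∀ j, d j ≠ b) (hab : G.Adj a b) : False := by
  classical
  have hN := two_mul_le_length hd hmax hreg h2 ha hb hab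
  have h3 := hd.three_le
  obtain ⟨l, hl, hl2⟩ := exists_isLongestAvoiding (G := G) (d := d) (l := [a, b])
    ⟨by simpa using hab, by simpa using hab.ne⟩
    (by
      intro c hc
      rcases List.mem_pair.1 hc with rfl | rfl <;> assumption)
  replace hl2 : 2 ≤ l.length := by simpa using hl2
  have hne : l ≠ [] := List.length_pos_iff_ne_nil.1 (by omega)
  obtain ⟨p, hp⟩ : ∃ p, p ∈ l.head? := ⟨_, List.head?_eq_some_head hne⟩
  obtain ⟨q, hq⟩ : ∃ q, q ∈ l.getLast? := ⟨_, List.getLast?_eq_some_getLast hne⟩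
  have hm := (hl.ends hd hmax hreg hk hN hl2 hp hq).2.1
  have hcard := hl.length_add_le hd
  set A := {c ∈ cycleSet N d | G.Adj p c} with hA
  have hAc : #A = degIn G p (cycleSet N d) := by rw [degIn]
  rw [← hAc] at hm
  have hadj : ∀ x ∈ l, ∀ j, G.Adj x (d j) ↔ d j ∈ A := by
    intro x hx j
    rw [hl.adj_iff hd hmax hreg hk hN hl2 hp hx (hd.apply_mem j), hA, mem_filter]
    exact ⟨fun h => ⟨hd.apply_mem j, h⟩, fun h => h.2⟩
  have hAd : ∀ s ∈ A, ∃ j, d j = s := fun s hs => (mem_cycleSet hd).1 (mem_filter.1 hs).1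
  have hPcard : #l.toFinset = l.length := List.toFinset_card_of_nodup hl.nodup
  have hPC : ∀ j, d j ∉ l.toFinset := fun j hj => hl.out _ (List.mem_toFinset.1 hj) j rfl
  have hgap : ∀ i j : ℤ, i < j → j < i + N → d i ∈ A → d j ∈ A → (l.length : ℤ) + 1 ≤ j - i :=
    fun i j hij hjN hi hj => hl.toIsPathList.length_lt_gap hd hmax hne hl.out hij hjN
      (fun x hx => (hadj x (List.mem_of_mem_head? hx) i).2 hi)
      (fun x hx => (hadj x (List.mem_of_mem_getLast? hx) j).2 hj)
  obtain ⟨f, hf⟩ := hd.exists_shift 1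
  set U := A.image f with hU
  have hUA : #U = #A := by
    refine card_image_of_injOn fun s hs s' hs' hss => ?_
    obtain ⟨i, rfl⟩ := hAd s hs
    obtain ⟨j, rfl⟩ := hAd s' hs'
    rw [hf, hf] at hss
    simpa using hd.congr_add hss (-1)
  have hsmall : ∀ s ∈ A, degIn G s U + 2 ≤ #A := by
    intro s hs
    obtain ⟨j, rfl⟩ := hAd s hs
    have e1 : degIn G (d j) l.toFinset = l.length := by
      rw [degIn_eq_card, hPcard]
      exact fun x hx => ((hadj x (List.mem_toFinset.1 hx) j).2 hs).symm
    have e2 : degIn G (d j) {d (j - 1)} = 1 := by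
      rw [degIn_eq_card, card_singleton]
      intro x hx
      rw [mem_singleton.1 hx]
      simpa using (hd.adj (j - 1)).symm
    have e3 : d (j - 1) ∉ U := by
      intro hmem
      obtain ⟨s', hs', he⟩ := mem_image.1 hmem
      obtain ⟨i, rfl⟩ := hAd s' hs'
      rw [hf] at he
      have e4 := hd.congr_add he (-1)
      rw [add_neg_cancel_right] at e4
      rw [e4] at hs'
      have := hgap _ j (by omega) (by omega) hs' hs
      omega
    have e5 : Disjoint l.toFinset {d (j - 1)} := by
      rw [disjoint_singleton_right]
      exact hPC _
    have e6 : Disjoint (l.toFinset ∪ {d (j - 1)}) U := by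
      rw [disjoint_union_left, disjoint_singleton_left]
      refine ⟨disjoint_right.2 fun x hx => ?_, e3⟩
      obtain ⟨s', hs', rfl⟩ := mem_image.1 hx
      obtain ⟨i, rfl⟩ := hAd s' hs'
      rw [hf]
      exact hPC _
    have e7 := degIn_mono (G := G) (d j) (subset_univ (l.toFinset ∪ {d (j - 1)} ∪ U))
    rw [degIn_union_of_disjoint _ e6, degIn_union_of_disjoint _ e5, hreg, e1, e2] at e7
    omega
  have hA0 : A.Nonempty := by
    rw [← card_pos]
    omega
  have hA2 : 2 ≤ #A := by
    obtain ⟨s, hs⟩ := hA0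
    have := hsmall s hs
    omega
  have hmN : l.length + 1 ≤ N := by omega
  have hpos : ∀ s, ∃ j, s ∈ A → d j = s := by
    intro s
    by_cases hs : s ∈ A
    · exact (hAd s hs).imp fun j hj _ => hj
    · exact ⟨0, fun h => absurd h hs⟩
  choose pos hpos using hpos
  set W := A.biUnion fun s => (arc d (pos s) (l.length + 1)).toFinset with hW
  have hkey : ∀ s ∈ A, ∀ s' ∈ A, ∀ i i', pos s ≤ i → i < pos s + (l.length + 1) → pos s' ≤ i' →
      i' < pos s' + (l.length + 1) → d i = d i' → i - pos s ≤ i' - pos s' → s = s' := by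
    intro s hs s' hs' i i' h1 h2 h3 h4 hii hle
    have e1 := hd.congr_add hii (pos s - i)
    rw [add_sub_cancel, hpos s hs] at e1
    have e2 := hpos s' hs'
    by_cases h5 : i' + (pos s - i) = pos s'
    · rw [h5] at e1
      exact e1.trans e2
    have := hgap (pos s') (i' + (pos s - i)) (by omega) (by omega) (e2.symm ▸ hs') (e1 ▸ hs)
    omega
  have hWcard : #W = #A * (l.length + 1) := by
    rw [hW, card_biUnion, sum_const_nat]
    · intro s _
      rw [List.toFinset_card_of_nodup (isPathList_arc hd hmN).nodup, length_arc]
    · intro s hs s' hs' hne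
      rw [Function.onFun, disjoint_left]
      intro c hc hc'
      obtain ⟨i, h1, h2, rfl⟩ := mem_arc.1 (List.mem_toFinset.1 hc)
      obtain ⟨j, h3, h4, hj⟩ := mem_arc.1 (List.mem_toFinset.1 hc')
      push_cast at h2 h4
      rcases le_total (i - pos s) (j - pos s') with hle | hle
      · exact hne (hkey s hs s' hs' i j h1 h2 h3 h4 hj.symm hle)
      · exact hne (hkey s' hs' s hs j i h3 h4 h1 h2 hj hle).symm
  have hPW : Disjoint l.toFinset W := by
    rw [disjoint_right]
    intro c hc
    obtain ⟨s, -, hc⟩ := mem_biUnion.1 hc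
    obtain ⟨i, -, -, rfl⟩ := mem_arc.1 (List.mem_toFinset.1 hc)
    exact hPC i
  have hZ : #(univ \ (l.toFinset ∪ W)) ≤ 1 := by
    have e1 := card_sdiff_add_card_eq_card (subset_univ (l.toFinset ∪ W))
    rw [card_union_of_disjoint hPW, hPcard, hWcard, card_univ] at e1
    obtain ⟨x, hx⟩ : ∃ x, #A = x + 2 := ⟨#A - 2, by omega⟩
    obtain ⟨y, hy⟩ : ∃ y, l.length = y + 2 := ⟨l.length - 2, by omega⟩
    rw [hx, hy] at e1 hm
    nlinarith [Nat.zero_le (x * y)]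
  have hlarge : ∀ u ∈ U, #A ≤ degIn G u A + 1 := by
    intro u hu
    obtain ⟨s, hs, rfl⟩ := mem_image.1 hu
    obtain ⟨j, rfl⟩ := hAd s hs
    rw [hf]
    set Y := (arc d (j + 2) (l.length - 1)).toFinset
    have hYc : #Y ≤ l.length - 1 := (List.toFinset_card_le _).trans (length_arc _ _).le
    have hcov : degIn G (d (j + 1)) (A ∪ Y ∪ (univ \ (l.toFinset ∪ W))) =
        degIn G (d (j + 1)) univ := by
      refine degIn_eq_of_forall (subset_univ _) fun c _ hc => ?_
      by_cases hcR : c ∈ l.toFinset ∪ W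
      · refine mem_union_left _ ?_
        rcases mem_union.1 hcR with hcP | hcW
        · have := (hadj c (List.mem_toFinset.1 hcP) (j + 1)).1 hc.symm
          have := hgap j (j + 1) (by omega) (by omega) hs this
          omega
        · obtain ⟨s', hs', hcW⟩ := mem_biUnion.1 hcW
          obtain ⟨i, h1, h2, rfl⟩ := mem_arc.1 (List.mem_toFinset.1 hcW)
          obtain ⟨j', g1, g2, g3, g4⟩ := hd.exists_rep j (pos s')
          have e1 := g4 (i - pos s')
          rw [add_sub_cancel] at e1
          have hj' : d j' ∈ A := by rwa [g3, hpos s' hs']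
          by_cases h0 : i = pos s'
          · rw [h0, hpos s' hs']
            exact mem_union_left _ hs'
          rw [← e1] at hc ⊢
          rcases g1.eq_or_lt with rfl | g1
          · by_cases h1' : i = pos s' + 1
            · rw [h1', add_sub_cancel_left] at hc
              exact absurd hc (G.irrefl)
            · exact mem_union_right _ (List.mem_toFinset.2
                (mem_arc.2 ⟨_, by omega, by omega, rfl⟩))
          · exfalso
            have e2 := hgap j' (j + N) (by omega) (by omega) hj' (by rwa [hd.per])
            have := hl.toIsPathList.length_lt_of_crossing hd hmax hne hl.out g1
              (t := i - pos s') (by omega) (by omega)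
              (fun x hx => (hadj x (List.mem_of_mem_head? hx) j).2 hs)
              (fun x hx => (hadj x (List.mem_of_mem_getLast? hx) j').2 hj') hc
            omega
      · exact mem_union_right _ (mem_sdiff.2 ⟨mem_univ _, hcR⟩)
    have e1 := degIn_union (G := G) (d (j + 1)) (A ∪ Y) (univ \ (l.toFinset ∪ W))
    have e2 := degIn_union (G := G) (d (j + 1)) A Y
    have e3 := degIn_le_card (G := G) (d (j + 1)) Y
    have e4 := degIn_le_card (G := G) (d (j + 1)) (univ \ (l.toFinset ∪ W))
    rw [hcov, hreg] at e1
    omega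
  have s1 := card_nsmul_le_sum U (fun u => degIn G u A) (#A - 1) fun u hu => by
    have := hlarge u hu
    omega
  have s2 := sum_le_card_nsmul A (fun s => degIn G s U) (#A - 2) fun s hs => by
    have := hsmall s hs
    omega
  rw [sum_degIn_comm, hUA] at s1
  have s3 := s1.trans s2
  rw [smul_eq_mul, smul_eq_mul] at s3
  have := Nat.le_of_mul_le_mul_left s3 (by omega)
  omega

end Jackson

namespace Jackson

open Finset

variable {V : Type*} {G : SimpleGraph V}

/-- A finite nonempty graph of minimum degree at least two contains a cycle. -/
theorem exists_isCycleList [Fintype V] [Nonempty V] (hdeg : ∀ a, 2 ≤ degIn G a univ) :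
    ∃ l, IsCycleList G l := by
  classical
  obtain ⟨l, hl, hmax⟩ := exists_longest (p := IsPathList G)
    ⟨[Classical.arbitrary V], isPathList_singleton _⟩ fun l hl => hl.length_le_card
  have hne : l ≠ [] := by
    rintro rfl
    simpa using hmax _ (isPathList_singleton (Classical.arbitrary V))
  obtain ⟨a, t, rfl⟩ := List.exists_cons_of_ne_nil hne
  have hmem : ∀ b, G.Adj a b → b ∈ a :: t := by
    intro b hab
    by_contra hb
    have := hmax ([b] ++ (a :: t)) ((isPathList_singleton b).append hl (by simpa using hb)
      (by simpa using hab.symm))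
    simp at this
  obtain ⟨b, hb, c, hc, hbc⟩ := one_lt_card.1 (hdeg a)
  replace hb := (mem_filter.1 hb).2
  replace hc := (mem_filter.1 hc).2
  have hbt : b ∈ t := (List.mem_cons.1 (hmem b hb)).resolve_left hb.ne'
  have hct : c ∈ t := (List.mem_cons.1 (hmem c hc)).resolve_left hc.ne'
  obtain ⟨s, b', r, ht, hs, hb'⟩ : ∃ s b' r, t = s ++ b' :: r ∧ s ≠ [] ∧ G.Adj a b' := by
    obtain ⟨s, r, ht⟩ := List.append_of_mem hbt
    rcases eq_or_ne s [] with rfl | hs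
    · obtain ⟨s', r', ht'⟩ := List.append_of_mem hct
      refine ⟨s', c, r', ht', ?_, hc⟩
      rintro rfl
      rw [ht] at ht'
      simp at ht'
      exact hbc ht'.1
    · exact ⟨s, b, r, ht, hs, hb⟩
  subst ht
  have hl' : IsPathList G ((a :: (s ++ [b'])) ++ r) := by simpa using hl
  have hs' := List.length_pos_of_ne_nil hs
  refine ⟨a :: (s ++ [b']), (isPathList_append.1 hl').1, by simp; omega, ?_⟩
  intro x hx y hy
  rw [← List.cons_append, List.getLast?_append_of_ne_nil _ (by simp)] at hx
  simp at hx hy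
  rw [← hx, ← hy]
  exact hb'.symm

/-- A 2-connected graph has minimum degree at least two. -/
theorem two_le_degIn [Fintype V] [DecidableEq V] (hn : 3 ≤ Fintype.card V)
    (h2 : ∀ v, ConnIn G (univ.erase v)) (a : V) : 2 ≤ degIn G a univ := by
  classical
  by_contra hlt
  have hw : ∃ w, w ≠ a ∧ ∀ b, G.Adj a b → b = w := by
    have hle : #{b ∈ univ | G.Adj a b} ≤ 1 := by
      rw [degIn] at hlt
      omega
    by_cases h0 : ∃ w, G.Adj a w
    · obtain ⟨w, hw⟩ := h0
      exact ⟨w, hw.ne', fun b hb => card_le_one.1 hle b (by simpa using hb) w (by simpa using hw)⟩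
    · push Not at h0
      have : Nontrivial V := Fintype.one_lt_card_iff_nontrivial.1 (by omega)
      obtain ⟨w, hw⟩ := exists_ne a
      exact ⟨w, hw, fun b hb => absurd hb (h0 b)⟩
  obtain ⟨w, hwa, hw⟩ := hw
  have := h2 w {a} ⟨by simpa using hwa.symm, by
    intro x hx b hb hxb
    rw [mem_singleton.1 hx] at hxb
    exact absurd (hw b hxb) (mem_erase.1 hb).1⟩ (by simp)
  have := congrArg card this
  rw [card_singleton, card_erase_of_mem (mem_univ _), card_univ] at this
  omega

theorem isHamiltonian_of_regular [Fintype V] [DecidableEq V] {k : ℕ} (hn : 3 ≤ Fintype.card V)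
    (h2 : ∀ v, ConnIn G (univ.erase v)) (hreg : ∀ a, degIn G a univ = k)
    (hk : Fintype.card V ≤ 3 * k) : G.IsHamiltonian := by
  have : Nonempty V := Fintype.card_pos_iff.1 (by omega)
  obtain ⟨l, hl, hmax⟩ := exists_longest (p := IsCycleList G)
    (exists_isCycleList (two_le_degIn hn h2)) fun l hl => hl.toIsPathList.length_le_card
  by_cases hall : ∀ a, a ∈ l
  · exact hl.isHamiltonian hall
  · exfalso
    push Not at hall
    obtain ⟨v, hv⟩ := hall
    obtain ⟨d, hd, hdl⟩ := hl.exists_isCycleFun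
    obtain ⟨X, Y, hXY⟩ := exists_isHopPair hd hmax (v := v)
      (fun j hj => hv ((hdl v).2 ⟨j, hj⟩)) (by
        intro l' hl' hlen a b ha hb hab
        obtain ⟨d', hd', hdl'⟩ := hl'.exists_isCycleFun
        exact false_of_adj_outside hd' (fun m hm => hlen ▸ hmax m hm) hreg hk h2
          (fun j hj => ha ((hdl' a).2 ⟨j, hj⟩)) (fun j hj => hb ((hdl' b).2 ⟨j, hj⟩)) hab)
    lift X to Finset V using X.toFinite
    lift Y to Finset V using Y.toFinite
    exact hXY.false_of_regular hreg hk

end Jackson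

/-- Jackson's theorem: every 2-connected `k`-regular graph on `n` vertices with `k ≥ n/3`
contains a Hamilton cycle. 2-connectedness: at least 3 vertices, connected, and still
connected after deleting any one vertex. -/
theorem stmt_14 {V : Type*} [Fintype V] [DecidableEq V] (G : SimpleGraph V)
    [DecidableRel G.Adj] (k : ℕ)
    (hn : 3 ≤ Fintype.card V) (hconn : G.Connected)
    (h2conn : ∀ v : V, (G.induce ({v}ᶜ : Set V)).Connected)
    (hreg : G.IsRegularOfDegree k) (hk : Fintype.card V ≤ 3 * k) :
    G.IsHamiltonian := by
  refine Jackson.isHamiltonian_of_regular hn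
    (fun v => Jackson.connIn_of_induce_connected (h2conn v)) (fun a => ?_) hk
  rw [← hreg a, ← G.card_neighborFinset_eq_degree, G.neighborFinset_eq_filter, Jackson.degIn]
  congr
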